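/- Let m, n be positive integers, 0 ≤ t ≤ min(m,n), and let w₁, w₂ be m×n partial permutation matrices of rank t, with the unique decompositions w₁ = y·I^{m,n}_t·v⁻¹ (y ∈ S_m with y(t+1)<⋯<y(m); v ∈ S_n with v(1)<⋯<v(t) and v(t+1)<⋯<v(n)) and w₂ = z·I^{m,n}_t·u⁻¹ (z ∈ S_m with z(1)<⋯<z(t) and z(t+1)<⋯<z(m); u ∈ S_n with u(t+1)<⋯<u(n)). Set B^{w₁,w₂} = B_m⁺ w₁ B_n⁺ ∩ B_m⁻ w₂ B_n⁻. Then: (a) B^{w₁,w₂} is nonempty if and only if z ≤ y and v ≤ u in the Bruhat order; (b) if z ≤ y and v ≤ u, then B^{w₁,w₂} is the disjoint union of the sets P^t_{(y, vτ₂, zτ₁, u)} over all pairs (τ₁, τ₂) where τ₁ ∈ S_m fixes {1,…,t} pointwise with zτ₁ ≤ y, and τ₂ ∈ S_n fixes {1,…,t} pointwise with vτ₂ ≤ u. Here P^t_{(y',v',z',u')} denotes the union, over all permutations τ fixing every index greater than t (viewed in both S_m and S_n) with z'τ ≤ y' and v'τ⁻¹ ≤ u', of the sets (B_m⁺ y'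 B_m⁺ ∩ B_m⁻·(z'τ)) · I^{m,n}_t · (τ⁻¹·(B_n⁻ u'⁻¹ B_n⁻) ∩ v'⁻¹·B_n⁺). -/

import Mathlib

open Matrix

noncomputable section

abbrev Mat (k l : ℕ) := Matrix (Fin k) (Fin l) ℂ

/-- permutation matrix: (i,j) entry is 1 exactly when i = w j -/
def permMat (k : ℕ) (w : Equiv.Perm (Fin k)) : Mat k k :=
  fun i j => if i = w j then 1 else 0

/-- invertible upper triangular matrices -/
def Bp (k : ℕ) : Set (Mat k k) := {M | IsUnit M ∧ ∀ i j : Fin k, j < i → M i j = 0}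

/-- invertible lower triangular matrices -/
def Bm (k : ℕ) : Set (Mat k k) := {M | IsUnit M ∧ ∀ i j : Fin k, i < j → M i j = 0}

def dcPlus {k l : ℕ} (w : Mat k l) : Set (Mat k l) :=
  {x | ∃ b ∈ Bp k, ∃ b' ∈ Bp l, x = b * w * b'}

def dcMinus {k l : ℕ} (w : Mat k l) : Set (Mat k l) :=
  {x | ∃ b ∈ Bm k, ∃ b' ∈ Bm l, x = b * w * b'}

/-- comparison of finsets: sorted lists compare termwise -/
def finsetLE {k : ℕ} (A B : Finset (Fin k)) : Prop :=
  List.Forall₂ (· ≤ ·) (A.sort (· ≤ ·)) (B.sort (· ≤ ·))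

/-- Bruhat order on S_k -/
def bruhatLE {k : ℕ} (y z : Equiv.Perm (Fin k)) : Prop :=
  ∀ p : Fin k, finsetLE ((Finset.Iic p).image y) ((Finset.Iic p).image z)

/-- Zariski closure in the space of k×l matrices -/
def zClosure {k l : ℕ} (S : Set (Mat k l)) : Set (Mat k l) :=
  {x | ∀ p : MvPolynomial (Fin k × Fin l) ℂ,
      (∀ y ∈ S, MvPolynomial.eval (fun q => y q.1 q.2) p = 0) →
      MvPolynomial.eval (fun q => x q.1 q.2) p = 0}

def revP (k : ℕ) : Equiv.Perm (Fin k) := ⟨Fin.rev, Fin.rev, Fin.rev_rev, Fin.rev_rev⟩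

def fe (m n : ℕ) : Fin n ⊕ Fin m ≃ Fin (m + n) :=
  finSumFinEquiv.trans (finCongr (Nat.add_comm n m))

/-- the block matrix [[w∘ⁿ, 0],[x, w∘ᵐ]] -/
def embMat (m n : ℕ) (x : Mat m n) : Mat (m+n) (m+n) :=
  Matrix.reindex (fe m n) (fe m n)
    (Matrix.fromBlocks (permMat n (revP n)) 0 x (permMat m (revP m)))

/-- the permutation (w∘ⁿ,w∘ᵐ) ∈ S_{m+n} -/
def wnmPerm (m n : ℕ) : Equiv.Perm (Fin (m+n)) :=
  ((fe m n).symm.trans (Equiv.sumCongr (revP n) (revP m))).trans (fe m n)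

def Pset (m n : ℕ) (w : Equiv.Perm (Fin (m+n))) : Set (Mat m n) :=
  {x | embMat m n x ∈ dcPlus (permMat (m+n) w)}

/-- the matrix with t×t identity in upper-left corner, zeros elsewhere -/
def Imn (m n t : ℕ) : Mat m n := fun i j => if (i:ℕ) = (j:ℕ) ∧ (i:ℕ) < t then 1 else 0

/-- diagonal matrix with first t diagonal entries 0 and the rest 1 -/
def Jk (k t : ℕ) : Mat k k := fun i j => if (i:ℕ) = (j:ℕ) ∧ t ≤ (i:ℕ) then 1 else 0

noncomputable def subRank {k l : ℕ} (x : Mat k l) (R : Finset (Fin k)) (C : Finset (Fin l)) : ℕ :=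
  (x.submatrix (fun i : {a // a ∈ R} => i.1) (fun j : {a // a ∈ C} => j.1)).rank

/-- v(1) < ⋯ < v(t) -/
def headMono {k : ℕ} (t : ℕ) (v : Equiv.Perm (Fin k)) : Prop :=
  ∀ i j : Fin k, i < j → (j:ℕ) < t → v i < v j

/-- u(t+1) < ⋯ < u(k) -/
def tailMono {k : ℕ} (t : ℕ) (u : Equiv.Perm (Fin k)) : Prop :=
  ∀ i j : Fin k, i < j → t ≤ (i:ℕ) → u i < u j

def embPerm {k t : ℕ} (h : t ≤ k) (τ : Equiv.Perm (Fin t)) : Equiv.Perm (Fin k) :=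
  τ.viaFintypeEmbedding (Fin.castLEEmb h)
/-- the set P^t_{(y,v,z,u)} -/
def Pt (m n t : ℕ) (htm : t ≤ m) (htn : t ≤ n)
    (y : Equiv.Perm (Fin m)) (v : Equiv.Perm (Fin n))
    (z : Equiv.Perm (Fin m)) (u : Equiv.Perm (Fin n)) : Set (Mat m n) :=
  {x | ∃ τ : Equiv.Perm (Fin t),
    bruhatLE (z * embPerm htm τ) y ∧ bruhatLE (v * (embPerm htn τ)⁻¹) u ∧
    ∃ g ∈ dcPlus (permMat m y) ∩ {g | ∃ b ∈ Bm m, g = b * permMat m (z * embPerm htm τ)},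
    ∃ h ∈ {h | ∃ c ∈ dcMinus (permMat n u⁻¹), h = permMat n (embPerm htn τ)⁻¹ * c} ∩
          {h | ∃ b ∈ Bp n, h = permMat n v⁻¹ * b},
    x = g * Imn m n t * h}


theorem Bp_iff {k : ℕ} {M : Mat k k} : M ∈ Bp k ↔ IsUnit M ∧ M.BlockTriangular id := by
  constructor
  · rintro ⟨h, h'⟩; exact ⟨h, fun i j hij => h' i j hij⟩
  · rintro ⟨h, h'⟩; exact ⟨h, fun i j hij => h' hij⟩

theorem Bp_unit {k : ℕ} {M : Mat k k} (h : M ∈ Bp k) : IsUnit M := h.1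

theorem Bp_one (k : ℕ) : (1 : Mat k k) ∈ Bp k :=
  ⟨isUnit_one, fun i j h => Matrix.one_apply_ne h.ne'⟩

theorem Bp_mul {k : ℕ} {M N : Mat k k} (h : M ∈ Bp k) (h' : N ∈ Bp k) : M * N ∈ Bp k := by
  rw [Bp_iff] at *
  exact ⟨h.1.mul h'.1, h.2.mul h'.2⟩

theorem Bp_inv {k : ℕ} {M : Mat k k} (h : M ∈ Bp k) : M⁻¹ ∈ Bp k := by
  rw [Bp_iff] at *
  haveI := h.1.invertible
  exact ⟨by simpa using h.1, Matrix.blockTriangular_inv_of_blockTriangular h.2⟩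

theorem Bm_iff {k : ℕ} {M : Mat k k} : M ∈ Bm k ↔ Mᵀ ∈ Bp k := by
  constructor
  · rintro ⟨h, h'⟩; exact ⟨by simpa [Matrix.isUnit_transpose] using h, fun i j hij => h' j i hij⟩
  · rintro ⟨h, h'⟩; exact ⟨by simpa [Matrix.isUnit_transpose] using h, fun i j hij => h' j i hij⟩

theorem Bm_unit {k : ℕ} {M : Mat k k} (h : M ∈ Bm k) : IsUnit M := h.1

theorem Bm_one (k : ℕ) : (1 : Mat k k) ∈ Bm k :=
  ⟨isUnit_one, fun i j h => Matrix.one_apply_ne h.ne⟩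

theorem Bm_mul {k : ℕ} {M N : Mat k k} (h : M ∈ Bm k) (h' : N ∈ Bm k) : M * N ∈ Bm k := by
  rw [Bm_iff] at *
  rw [Matrix.transpose_mul]; exact Bp_mul h' h

theorem Bm_inv {k : ℕ} {M : Mat k k} (h : M ∈ Bm k) : M⁻¹ ∈ Bm k := by
  rw [Bm_iff] at *
  rw [Matrix.transpose_nonsing_inv]; exact Bp_inv h

theorem Bp_of_diag {k : ℕ} {M : Mat k k} (h : ∀ i j : Fin k, j < i → M i j = 0)
    (hd : ∀ i, M i i ≠ 0) : M ∈ Bp k := by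
  refine ⟨?_, h⟩
  rw [Matrix.isUnit_iff_isUnit_det, Matrix.det_of_upperTriangular (fun i j hij => h i j hij)]
  exact isUnit_iff_ne_zero.2 (Finset.prod_ne_zero_iff.2 fun i _ => hd i)

theorem Bm_of_diag {k : ℕ} {M : Mat k k} (h : ∀ i j : Fin k, i < j → M i j = 0)
    (hd : ∀ i, M i i ≠ 0) : M ∈ Bm k := by
  rw [Bm_iff]
  exact Bp_of_diag (fun i j hij => h j i hij) hd

theorem Bp_diag {k : ℕ} {M : Mat k k} (h : M ∈ Bp k) (i : Fin k) : M i i ≠ 0 := by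
  have h1 := h.1
  rw [Matrix.isUnit_iff_isUnit_det, Matrix.det_of_upperTriangular (fun i j hij => h.2 i j hij)] at h1
  exact Finset.prod_ne_zero_iff.1 h1.ne_zero i (Finset.mem_univ i)

theorem perm_mul_apply {k l : ℕ} (w : Equiv.Perm (Fin k)) (M : Mat k l) (i j) :
    (permMat k w * M) i j = M (w⁻¹ i) j := by
  rw [Matrix.mul_apply, Finset.sum_eq_single (w⁻¹ i)]
  · simp [permMat]
  · intro b _ hb
    have : i ≠ w b := by rintro rfl; simp at hb
    simp [permMat, this]
  · simp

theorem mul_perm_apply {k l : ℕ} (w : Equiv.Perm (Fin k)) (M : Mat l k) (i j) :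
    (M * permMat k w) i j = M i (w j) := by
  rw [Matrix.mul_apply, Finset.sum_eq_single (w j)]
  · simp [permMat]
  · intro b _ hb; simp [permMat, hb]
  · simp

theorem perm_mul {k : ℕ} (w w' : Equiv.Perm (Fin k)) :
    permMat k (w * w') = permMat k w * permMat k w' := by
  ext i j; rw [mul_perm_apply]; rfl

theorem perm_one (k : ℕ) : permMat k 1 = 1 := by
  ext i j
  by_cases h : i = j
  · subst h; simp [permMat]
  · simp [permMat, h]

theorem perm_T {k : ℕ} (w : Equiv.Perm (Fin k)) : (permMat k w)ᵀ = permMat k w⁻¹ := by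
  ext i j
  simp only [permMat, Matrix.transpose_apply, Equiv.Perm.eq_inv_iff_eq, eq_comm]

theorem perm_mul_inv {k : ℕ} (w : Equiv.Perm (Fin k)) : permMat k w * permMat k w⁻¹ = 1 := by
  rw [← perm_mul, mul_inv_cancel, perm_one]

theorem perm_inv_mul {k : ℕ} (w : Equiv.Perm (Fin k)) : permMat k w⁻¹ * permMat k w = 1 := by
  rw [← perm_mul, inv_mul_cancel, perm_one]

theorem perm_unit {k : ℕ} (w : Equiv.Perm (Fin k)) : IsUnit (permMat k w) :=
  ⟨⟨_, _, perm_mul_inv w, perm_inv_mul w⟩, rfl⟩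

theorem perm_inv {k : ℕ} (w : Equiv.Perm (Fin k)) : (permMat k w)⁻¹ = permMat k w⁻¹ :=
  Matrix.inv_eq_right_inv (perm_mul_inv w)

/-! ### LPU decomposition -/

theorem lpu_aux {k : ℕ} (A : Mat k k) (hA : IsUnit A) (j : ℕ) (hj : j ≤ k) :
    ∃ L ∈ Bm k, ∃ U ∈ Bp k, ∃ w : Fin k → Fin k, ∀ c : Fin k, (c : ℕ) < j →
      ∀ i, (L * A * U) i c = if i = w c then 1 else 0 := by
  induction j with
  | zero => exact ⟨1, Bm_one k, 1, Bp_one k, id, by simp⟩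
  | succ j ih =>
    obtain ⟨L, hL, U, hU, w, hw⟩ := ih (by omega)
    set B := L * A * U with hB
    have hBu : IsUnit B := (hL.1.mul hA).mul hU.1
    have hinj : ∀ (X : Mat k k), IsUnit X → ∀ a b : Fin k, (∀ i, X i a = X i b) → a = b := by
      intro X hX a b hab
      have h1 : X *ᵥ (Pi.single a 1) = X *ᵥ (Pi.single b 1) := by
        ext i; simp [hab i]
      have h2 := (Matrix.mulVec_injective_iff_isUnit.2 hX) h1
      by_contra hne
      have := congrFun h2 a
      simp [Pi.single_apply, hne] at this
    have hwi : ∀ a b : Fin k, (a:ℕ) < j → (b:ℕ) < j → w a = w b → a = b := by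
      intro a b ha hb hab
      exact hinj B hBu a b fun i => by rw [hw a ha, hw b hb, hab]
    let J : Fin k := ⟨j, by omega⟩
    let U1 : Mat k k := fun a b => if b = J ∧ a < J then - B (w a) J else if a = b then 1 else 0
    have hU1 : U1 ∈ Bp k := by
      apply Bp_of_diag
      · intro a b hab
        have h1 : ¬ (b = J ∧ a < J) := by rintro ⟨rfl, h⟩; exact absurd h (not_lt.2 hab.le)
        simp [U1, h1, hab.ne']
      · intro a
        have h1 : ¬ (a = J ∧ a < J) := by rintro ⟨rfl, h⟩; exact lt_irrefl _ h
        simp [U1, h1]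
    set C := B * U1 with hC
    have hCu : IsUnit C := hBu.mul hU1.1
    have hC1 : ∀ c : Fin k, (c:ℕ) < j → ∀ i, C i c = if i = w c then 1 else 0 := by
      intro c hc i
      have hne : c ≠ J := by rintro rfl; simp [J] at hc
      rw [← hw c hc, hC, Matrix.mul_apply, Finset.sum_eq_single c]
      · simp [U1, hne]
      · intro b _ hb; simp [U1, hne, hb]
      · simp
    have hC2 : ∀ c : Fin k, (c:ℕ) < j → C (w c) J = 0 := by
      intro c hc
      have hne : c ≠ J := by rintro rfl; simp [J] at hc
      have hlt : c < J := hc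
      rw [hC, Matrix.mul_apply, ← Finset.add_sum_erase _ _ (Finset.mem_univ c),
        ← Finset.add_sum_erase _ _ (Finset.mem_erase.2 ⟨hne.symm, Finset.mem_univ J⟩),
        Finset.sum_eq_zero]
      · rw [hw c hc]; simp [U1, hlt]
      · intro b hb
        simp only [Finset.mem_erase] at hb
        by_cases hbJ : b < J
        · have : w c ≠ w b := fun h => hb.2.1 (hwi c b hc hbJ h).symm
          rw [hw b hbJ]; simp [this]
        · simp [U1, hbJ, hb.1]
    have hne : ∃ a, C a J ≠ 0 := by
      by_contra hcon
      push Not at hcon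
      have h1 : C *ᵥ (Pi.single J 1) = C *ᵥ 0 := by ext i; simp [hcon i]
      have h2 := (Matrix.mulVec_injective_iff_isUnit.2 hCu) h1
      have := congrFun h2 J
      simp at this
    obtain ⟨a, ha, hmin⟩ : ∃ a, C a J ≠ 0 ∧ ∀ b, b < a → C b J = 0 := by
      obtain ⟨a, h1, h2⟩ := WellFounded.has_min (r := ((· < ·) : Fin k → Fin k → Prop))
        wellFounded_lt {a | C a J ≠ 0} hne
      exact ⟨a, h1, fun b hb => by_contra fun h => h2 b h hb⟩
    let L1 : Mat k k := fun p q => if q = a then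
        (if p < a then 0 else if p = a then (C a J)⁻¹ else - C p J / C a J)
      else if p = q then 1 else 0
    have hL1 : L1 ∈ Bm k := by
      apply Bm_of_diag
      · intro p q hpq
        by_cases hq : q = a
        · subst hq; simp [L1, hpq]
        · simp [L1, hq, hpq.ne]
      · intro p
        by_cases hq : p = a
        · subst hq; simp [L1, ha]
        · simp [L1, hq]
    have key : ∀ i c, (L1 * C) i c = L1 i a * C a c + if i = a then 0 else C i c := by
      intro i c
      rw [Matrix.mul_apply, ← Finset.add_sum_erase _ _ (Finset.mem_univ a)]
      congr 1
      by_cases hia : i = a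
      · rw [if_pos hia, Finset.sum_eq_zero]
        intro q hq
        simp only [Finset.mem_erase] at hq
        have : i ≠ q := fun h => hq.1 (h ▸ hia)
        simp [L1, hq.1, this]
      · rw [if_neg hia, Finset.sum_eq_single i]
        · simp [L1, hia]
        · intro q hq hne'
          simp only [Finset.mem_erase] at hq
          simp [L1, hq.1, hne'.symm]
        · simp [hia]
    refine ⟨L1 * L, Bm_mul hL1 hL, U * U1, Bp_mul hU hU1, Function.update w J a, ?_⟩
    intro c hc i
    have e : L1 * L * A * (U * U1) = L1 * C := by rw [hC, hB]; simp only [Matrix.mul_assoc]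
    rw [e, key]
    by_cases hcJ : c = J
    · subst hcJ
      simp only [Function.update_self]
      by_cases hia : i = a
      · subst hia; simp [L1, ha]
      · by_cases hlt : i < a
        · simp [L1, hia, hlt, hmin i hlt]
        · simp [L1, hia, hlt, ha]
    · have hc' : (c:ℕ) < j := by
        have : (c:ℕ) ≠ j := fun h => hcJ (Fin.ext h)
        omega
      rw [Function.update_of_ne hcJ]
      have haw : a ≠ w c := by rintro rfl; exact ha (hC2 c hc')
      rw [hC1 c hc' a, if_neg haw, mul_zero, zero_add]
      by_cases hia : i = a
      · subst hia; simp [haw]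
      · rw [if_neg hia, hC1 c hc']

theorem lpu {k : ℕ} (A : Mat k k) (hA : IsUnit A) :
    ∃ L ∈ Bm k, ∃ w : Equiv.Perm (Fin k), ∃ U ∈ Bp k, A = L * permMat k w * U := by
  obtain ⟨L, hL, U, hU, w, hw⟩ := lpu_aux A hA k le_rfl
  have hBu : IsUnit (L * A * U) := (hL.1.mul hA).mul hU.1
  have hinj : Function.Injective w := by
    intro a b hab
    have h1 : (L * A * U) *ᵥ (Pi.single a 1) = (L * A * U) *ᵥ (Pi.single b 1) := by
      ext i; simp [hw a a.2, hw b b.2, hab]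
    have h2 := (Matrix.mulVec_injective_iff_isUnit.2 hBu) h1
    by_contra hne
    have := congrFun h2 a
    simp [Pi.single_apply, hne] at this
  let W : Equiv.Perm (Fin k) := Equiv.ofBijective w (Finite.injective_iff_bijective.1 hinj)
  have hW : L * A * U = permMat k W := by
    ext i c; rw [hw c c.2]; rfl
  refine ⟨L⁻¹, Bm_inv hL, W, U⁻¹, Bp_inv hU, ?_⟩
  have h1 := (Matrix.isUnit_iff_isUnit_det _).1 hL.1
  have h2 := (Matrix.isUnit_iff_isUnit_det _).1 hU.1
  rw [← hW, Matrix.mul_assoc L A U, Matrix.nonsing_inv_mul_cancel_left _ _ h1,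
    Matrix.mul_nonsing_inv_cancel_right _ _ h2]

/-! ### Bruhat order via counting -/

def cnt {k : ℕ} (w : Equiv.Perm (Fin k)) (p q : ℕ) : ℕ :=
  (Finset.univ.filter fun i : Fin k => (i : ℕ) < p ∧ (w i : ℕ) < q).card

theorem forall2_countP {α : Type*} [LinearOrder α] (l1 l2 : List α)
    (h1 : l1.Pairwise (· ≤ ·)) (h2 : l2.Pairwise (· ≤ ·)) (hl : l1.length = l2.length) :
    List.Forall₂ (· ≤ ·) l1 l2 ↔
      ∀ q, l2.countP (fun x => decide (x < q)) ≤ l1.countP (fun x => decide (x < q)) := by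
  induction l1 generalizing l2 with
  | nil =>
    cases l2 with
    | nil => simp
    | cons b bs => simp at hl
  | cons a as ih =>
    cases l2 with
    | nil => simp at hl
    | cons b bs =>
      rw [List.pairwise_cons] at h1 h2
      have hl' : as.length = bs.length := by simpa using hl
      rw [List.forall₂_cons, ih bs h1.2 h2.2 hl']
      have zero : ∀ (c : α) (cs : List α), (∀ x ∈ cs, c ≤ x) → ∀ q, q ≤ c →
          cs.countP (fun x => decide (x < q)) = 0 := by
        intro c cs hc q hq
        rw [List.countP_eq_zero]
        intro x hx
        simpa using hq.trans (hc x hx)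
      constructor
      · rintro ⟨hab, h⟩ q
        simp only [List.countP_cons]
        have := h q
        by_cases hb : b < q
        · simp [hb, hab.trans_lt hb, this]
        · simp [hb]; omega
      · intro h
        have hab : a ≤ b := by
          by_contra hlt
          push Not at hlt
          have := h a
          simp only [List.countP_cons, zero a as h1.1 a le_rfl] at this
          simp [hlt] at this
        refine ⟨hab, fun q => ?_⟩
        by_cases hb : b < q
        · have := h q
          simpa [List.countP_cons, hb, hab.trans_lt hb] using this
        · rw [zero b bs h2.1 q (not_lt.1 hb)]; exact Nat.zero_le _

theorem countP_sort {k : ℕ} (A : Finset (Fin k)) (q : Fin k) :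
    (A.sort (· ≤ ·)).countP (fun x => decide (x < q)) = (A.filter (· < q)).card := by
  have := Multiset.coe_countP (p := fun x => x < q) (A.sort (· ≤ ·))
  rw [← this, Finset.sort_eq, Multiset.countP_eq_card_filter]; rfl

theorem bruhat_iff_fin {k : ℕ} (z y : Equiv.Perm (Fin k)) :
    bruhatLE z y ↔ ∀ p q : Fin k, cnt y (p + 1) q ≤ cnt z (p + 1) q := by
  unfold bruhatLE finsetLE
  refine forall_congr' fun p => ?_
  rw [forall2_countP _ _ (Finset.pairwise_sort _ _) (Finset.pairwise_sort _ _)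
    (by simp [Finset.card_image_of_injective _ (Equiv.injective _)])]
  refine forall_congr' fun q => ?_
  have : ∀ w : Equiv.Perm (Fin k),
      (((Finset.Iic p).image w).filter (· < q)).card = cnt w (p + 1) q := by
    intro w
    rw [Finset.filter_image, Finset.card_image_of_injective _ w.injective, cnt]
    congr 1
    ext i
    simp only [Finset.mem_filter, Finset.mem_Iic, Finset.mem_univ, true_and, Fin.lt_def, Fin.le_def]
    omega
  rw [countP_sort, countP_sort, this, this]

theorem cnt_top {k : ℕ} (w : Equiv.Perm (Fin k)) (p q : ℕ) (hq : k ≤ q) :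
    cnt w p q = (Finset.univ.filter fun i : Fin k => (i : ℕ) < p).card := by
  unfold cnt; congr 1; ext i
  have := (w i).2
  simp; omega

theorem cnt_big {k : ℕ} (w : Equiv.Perm (Fin k)) (p q : ℕ) (hp : k ≤ p) :
    cnt w p q = cnt w k q := by
  unfold cnt; congr 1; ext i
  have := i.2
  simp only [Finset.mem_filter, Finset.mem_univ, true_and]; omega

theorem bruhat_iff {k : ℕ} (z y : Equiv.Perm (Fin k)) :
    bruhatLE z y ↔ ∀ p q : ℕ, cnt y p q ≤ cnt z p q := by
  rw [bruhat_iff_fin]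
  constructor
  · intro h p q
    by_cases hq : k ≤ q
    · rw [cnt_top _ _ _ hq, cnt_top _ _ _ hq]
    push Not at hq
    have small : ∀ p ≤ k, cnt y p q ≤ cnt z p q := by
      intro p hp
      cases p with
      | zero => simp [cnt]
      | succ p => exact h ⟨p, hp⟩ ⟨q, hq⟩
    rcases le_total p k with hp | hp
    · exact small p hp
    · rw [cnt_big y p q hp, cnt_big z p q hp]; exact small k le_rfl
  · intro h p q; exact h _ _

theorem bruhat_trans {k : ℕ} {x y z : Equiv.Perm (Fin k)} (h : bruhatLE x y) (h' : bruhatLE y z) :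
    bruhatLE x z := by
  rw [bruhat_iff] at *
  exact fun p q => (h' p q).trans (h p q)

/-- sorting within a window goes down -/
theorem bruhat_window {k : ℕ} (w σ : Equiv.Perm (Fin k)) (S : Set (Fin k))
    (hw : ∀ i ∈ S, ∀ j ∈ S, i < j → w i < w j) (hσ : ∀ i, i ∉ S → σ i = i) :
    bruhatLE w (w * σ) := by
  have hσ' : ∀ i, i ∈ S → σ i ∈ S := by
    intro i hi
    by_contra h
    have := hσ _ h
    rw [σ.injective this] at h
    exact h hi
  rw [bruhat_iff]
  intro p q
  by_cases h : ∃ i0 ∈ S, (i0 : ℕ) < p ∧ q ≤ (w i0 : ℕ)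
  · obtain ⟨i0, hS, hp, hq⟩ := h
    unfold cnt
    apply Finset.card_le_card_of_injOn σ
    · intro i hi
      simp only [Finset.coe_filter, Finset.mem_univ, true_and, Set.mem_setOf_eq] at hi ⊢
      rw [Equiv.Perm.mul_apply] at hi
      refine ⟨?_, hi.2⟩
      by_cases hiS : i ∈ S
      · by_contra hcon
        have hlt : i0 < σ i := by rw [Fin.lt_def]; omega
        have := hw _ hS _ (hσ' i hiS) hlt
        rw [Fin.lt_def] at this
        omega
      · rw [hσ i hiS]; exact hi.1
    · exact σ.injective.injOn
  · push Not at h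
    have tot : ∀ w : Equiv.Perm (Fin k), cnt w p q +
        (Finset.univ.filter fun i : Fin k => (i : ℕ) < p ∧ ¬ (w i : ℕ) < q).card =
        (Finset.univ.filter fun i : Fin k => (i : ℕ) < p).card := by
      intro w
      rw [cnt, ← Finset.filter_filter, ← Finset.filter_filter]
      exact Finset.card_filter_add_card_filter_not _
    have h1 := tot w
    have h2 := tot (w * σ)
    have h3 : (Finset.univ.filter fun i : Fin k => (i : ℕ) < p ∧ ¬ (w i : ℕ) < q).card ≤
        (Finset.univ.filter fun i : Fin k => (i : ℕ) < p ∧ ¬ ((w * σ) i : ℕ) < q).card := by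
      apply Finset.card_le_card
      intro i hi
      simp only [Finset.mem_filter, Finset.mem_univ, true_and] at hi ⊢
      refine ⟨hi.1, ?_⟩
      have hiS : i ∉ S := fun hS => hi.2 (h i hS hi.1)
      rw [Equiv.Perm.mul_apply, hσ i hiS]; exact hi.2
    omega

theorem cnt_succ {k : ℕ} (w : Equiv.Perm (Fin k)) (p q : ℕ) (hp : p < k) :
    cnt w (p + 1) q = cnt w p q + if (w ⟨p, hp⟩ : ℕ) < q then 1 else 0 := by
  unfold cnt
  by_cases h : (w ⟨p, hp⟩ : ℕ) < q
  · rw [if_pos h]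
    have : (Finset.univ.filter fun i : Fin k => (i : ℕ) < p + 1 ∧ (w i : ℕ) < q) =
      insert ⟨p, hp⟩ (Finset.univ.filter fun i : Fin k => (i : ℕ) < p ∧ (w i : ℕ) < q) := by
      ext i
      simp only [Finset.mem_filter, Finset.mem_univ, true_and, Finset.mem_insert]
      by_cases hi : i = ⟨p, hp⟩
      · subst hi; simp [h]
      · have : (i : ℕ) ≠ p := fun h => hi (Fin.ext h)
        simp only [hi, false_or]; omega
    rw [this, Finset.card_insert_of_notMem (by simp)]
  · rw [if_neg h, add_zero]
    congr 1; ext i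
    simp only [Finset.mem_filter, Finset.mem_univ, true_and]
    by_cases hi : i = ⟨p, hp⟩
    · subst hi; simp [h]
    · have : (i : ℕ) ≠ p := fun h => hi (Fin.ext h)
      omega

theorem cnt_swap {k : ℕ} (w : Equiv.Perm (Fin k)) (j : ℕ) (hj : j + 1 < k) (p q : ℕ)
    (hp : p ≠ j + 1) :
    cnt (w * Equiv.swap ⟨j, by omega⟩ ⟨j + 1, hj⟩) p q = cnt w p q := by
  have hj' : j < k := by omega
  unfold cnt
  apply Finset.card_bij (fun i _ => (Equiv.swap ⟨j, hj'⟩ ⟨j + 1, hj⟩ : Equiv.Perm (Fin k)) i)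
  · intro i hi
    simp only [Finset.mem_filter, Finset.mem_univ, true_and] at hi ⊢
    rw [Equiv.Perm.mul_apply] at hi
    refine ⟨?_, hi.2⟩
    rw [Equiv.swap_apply_def]
    split_ifs with h1 h2
    · rw [Fin.ext_iff] at h1; simp at h1 ⊢; omega
    · rw [Fin.ext_iff] at h2; simp at h2 ⊢; omega
    · exact hi.1
  · intro a _ b _ h; exact Equiv.injective _ h
  · intro i hi
    simp only [Finset.mem_filter, Finset.mem_univ, true_and] at hi
    refine ⟨(Equiv.swap ⟨j, hj'⟩ ⟨j + 1, hj⟩ : Equiv.Perm (Fin k)) i, ?_, by simp⟩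
    simp only [Finset.mem_filter, Finset.mem_univ, true_and]
    rw [Equiv.Perm.mul_apply]
    refine ⟨?_, by simpa using hi.2⟩
    rw [Equiv.swap_apply_def]
    split_ifs with h1 h2
    · rw [Fin.ext_iff] at h1; simp at h1 ⊢; omega
    · rw [Fin.ext_iff] at h2; simp at h2 ⊢; omega
    · exact hi.1

/-- the lifting property -/
theorem lifting {k : ℕ} (y z a : Equiv.Perm (Fin k)) (j : ℕ) (hj : j + 1 < k)
    (ha : a ⟨j, by omega⟩ < a ⟨j + 1, hj⟩)
    (hza : z = a ∨ z = a * Equiv.swap ⟨j, by omega⟩ ⟨j + 1, hj⟩) (h : bruhatLE z y) :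
    bruhatLE a (y * Equiv.swap ⟨j, by omega⟩ ⟨j + 1, hj⟩) := by
  rw [bruhat_iff] at *
  have hz : ∀ p q, p ≠ j + 1 → cnt z p q = cnt a p q := by
    intro p q hp
    rcases hza with rfl | rfl
    · rfl
    · exact cnt_swap a j hj p q hp
  intro p q
  by_cases hp : p = j + 1
  · subst hp
    have h1 := h j q
    have h2 := h (j + 1 + 1) q
    rw [hz _ _ (by omega)] at h1 h2
    rw [cnt_succ _ _ _ hj, cnt_succ _ _ _ (by omega : j < k), cnt_succ _ _ _ hj,
      cnt_succ _ _ _ (by omega : j < k)] at h2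
    rw [cnt_succ _ _ _ (by omega : j < k), cnt_succ _ _ _ (by omega : j < k),
      cnt_swap _ _ hj _ _ (by omega)]
    rw [Equiv.Perm.mul_apply, Equiv.swap_apply_left]
    rw [Fin.lt_def] at ha
    split_ifs at h2 ⊢ <;> omega
  · rw [cnt_swap _ _ hj _ _ hp, ← hz _ _ hp]; exact h p q

/-! ### Richardson cells -/

theorem unit_det {k : ℕ} {M : Mat k k} (h : IsUnit M) : IsUnit M.det :=
  (Matrix.isUnit_iff_isUnit_det _).1 h

/-- nonempty intersection implies Bruhat comparability -/
theorem bruhat_of_mem {k : ℕ} (y z : Equiv.Perm (Fin k)) (g : Mat k k)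
    (hg : g ∈ dcPlus (permMat k y)) (hg' : ∃ b ∈ Bm k, g = b * permMat k z) : bruhatLE z y := by
  obtain ⟨b1, hb1, b2, hb2, e1⟩ := hg
  obtain ⟨c, hc, e2⟩ := hg'
  have appinv : ∀ (w : Equiv.Perm (Fin k)) l, w (w⁻¹ l) = l := fun w l => by simp
  rw [bruhat_iff]
  intro p q
  have hN := Bp_inv hb2
  set N := b2⁻¹ with hNdef
  -- c * z * N = b1 * y
  have e : c * permMat k z * N = b1 * permMat k y := by
    rw [← e2, e1, hNdef, Matrix.mul_nonsing_inv_cancel_right _ _ (unit_det hb2.1)]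
  let S := {i : Fin k // (i : ℕ) < p ∧ (y i : ℕ) < q}
  let T := {i : Fin k // (i : ℕ) < p ∧ (z i : ℕ) < q}
  have hS : Fintype.card S = cnt y p q := by rw [Fintype.card_subtype]; rfl
  have hT : Fintype.card T = cnt z p q := by rw [Fintype.card_subtype]; rfl
  rw [← hS, ← hT]
  let Q : Matrix T S ℂ := fun i j => N i.1 j.1
  have hinj : Function.Injective (Matrix.mulVecLin Q) := by
    rw [← LinearMap.ker_eq_bot, LinearMap.ker_eq_bot']
    intro β hβ
    let β' : Fin k → ℂ := fun i => if h : (i : ℕ) < p ∧ (y i : ℕ) < q then β ⟨i, h⟩ else 0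
    have hβ'0 : ∀ i : Fin k, ¬ ((i : ℕ) < p ∧ (y i : ℕ) < q) → β' i = 0 := by
      intro i hi; simp only [β', dif_neg hi]
    let α : Fin k → ℂ := N *ᵥ β'
    have hα1 : ∀ i : Fin k, (i:ℕ) < p → (z i : ℕ) < q → α i = 0 := by
      intro i h1 h2
      have this : ∑ a : S, N i a.1 * β a = 0 := congrFun hβ ⟨i, h1, h2⟩
      simp only [α, Matrix.mulVec, dotProduct]
      rw [← this]
      symm
      refine Finset.sum_of_injOn (fun a : S => a.1) Subtype.val_injective.injOn
        (fun _ _ => Finset.mem_coe.2 (Finset.mem_univ _))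
        (fun x _ hx => ?_) (fun a _ => ?_)
      · have : ¬ ((x : ℕ) < p ∧ (y x : ℕ) < q) := fun h => hx ⟨⟨x, h⟩, by simp, rfl⟩
        rw [hβ'0 x this, mul_zero]
      · have h3 : β' a.1 = β a := dif_pos a.2
        rw [h3]
    have hα2 : ∀ i : Fin k, p ≤ (i:ℕ) → α i = 0 := by
      intro i hi
      simp only [α, Matrix.mulVec, dotProduct]
      apply Finset.sum_eq_zero
      intro l _
      by_cases hl : (l:ℕ) < p
      · rw [hN.2 i l (by rw [Fin.lt_def]; omega), zero_mul]
      · rw [hβ'0 l (by tauto), mul_zero]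
    have pm : ∀ (w : Equiv.Perm (Fin k)) (x : Fin k → ℂ) i, (permMat k w *ᵥ x) i = x (w⁻¹ i) := by
      intro w x i
      simp only [Matrix.mulVec, dotProduct]
      rw [Finset.sum_eq_single (w⁻¹ i)]
      · simp [permMat]
      · intro b _ hb
        have : i ≠ w b := by rintro rfl; simp at hb
        simp [permMat, this]
      · simp
    have hv : c *ᵥ (permMat k z *ᵥ α) = b1 *ᵥ (permMat k y *ᵥ β') := by
      simp only [α, Matrix.mulVec_mulVec, e]
      rw [← e]; simp only [Matrix.mul_assoc]
    have hzero : c *ᵥ (permMat k z *ᵥ α) = 0 := by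
      ext i
      by_cases hi : (i:ℕ) < q
      · simp only [Matrix.mulVec, dotProduct]
        apply Finset.sum_eq_zero
        intro l _
        by_cases hl : i < l
        · rw [hc.2 i l hl, zero_mul]
        · have : (permMat k z *ᵥ α) l = 0 := by
            rw [pm]
            by_cases h : ((z⁻¹ l : Fin k) : ℕ) < p
            · apply hα1 _ h
              rw [appinv]
              rw [Fin.lt_def] at hl; omega
            · exact hα2 _ (by omega)
          simp only [Matrix.mulVec, dotProduct] at this
          rw [this, mul_zero]
      · rw [hv]
        simp only [Matrix.mulVec, dotProduct]
        apply Finset.sum_eq_zero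
        intro l _
        by_cases hl : l < i
        · rw [hb1.2 i l hl, zero_mul]
        · have : (permMat k y *ᵥ β') l = 0 := by
            rw [pm]
            apply hβ'0
            rw [appinv]
            rw [Fin.lt_def] at hl; omega
          simp only [Matrix.mulVec, dotProduct] at this
          rw [this, mul_zero]
    rw [hv] at hzero
    have h0 : permMat k y *ᵥ β' = 0 :=
      (Matrix.mulVec_injective_iff_isUnit.2 hb1.1) (by rw [hzero, Matrix.mulVec_zero])
    have h1 : β' = 0 :=
      (Matrix.mulVec_injective_iff_isUnit.2 (perm_unit y)) (by rw [h0, Matrix.mulVec_zero])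
    ext i
    have := congrFun h1 i.1
    simpa [β', i.2] using this
  have := LinearMap.finrank_le_finrank_of_injective hinj
  simpa using this

theorem dcPlus_mul_right {k l : ℕ} {w g : Mat k l} {b : Mat l l} (hg : g ∈ dcPlus w) (hb : b ∈ Bp l) :
    g * b ∈ dcPlus w := by
  obtain ⟨b1, hb1, b2, hb2, rfl⟩ := hg
  exact ⟨b1, hb1, b2 * b, Bp_mul hb2 hb, by simp only [Matrix.mul_assoc]⟩

theorem perm_mul_transvection {k : ℕ} (w : Equiv.Perm (Fin k)) (i j : Fin k) (c : ℂ) :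
    permMat k w * transvection i j c = transvection (w i) (w j) c * permMat k w := by
  ext a b
  rw [perm_mul_apply, mul_perm_apply]
  simp only [transvection, Matrix.add_apply, Matrix.one_apply, Matrix.single_apply]
  simp only [Equiv.Perm.inv_eq_iff_eq, Equiv.Perm.eq_inv_iff_eq, EmbeddingLike.apply_eq_iff_eq]

theorem transvection_Bp {k : ℕ} {i j : Fin k} (h : i < j) (c : ℂ) : transvection i j c ∈ Bp k := by
  apply Bp_of_diag
  · intro a b hab
    have : ¬ (i = a ∧ j = b) := by rintro ⟨rfl, rfl⟩; exact absurd h (not_lt.2 hab.le)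
    simp [transvection, Matrix.single_apply, this, Matrix.one_apply, hab.ne']
  · intro a
    have : ¬ (i = a ∧ j = a) := by rintro ⟨rfl, rfl⟩; exact absurd h (lt_irrefl _)
    simp [transvection, Matrix.single_apply, this]

theorem transvection_Bm {k : ℕ} {i j : Fin k} (h : j < i) (c : ℂ) : transvection i j c ∈ Bm k := by
  apply Bm_of_diag
  · intro a b hab
    have : ¬ (i = a ∧ j = b) := by rintro ⟨rfl, rfl⟩; exact absurd h (not_lt.2 hab.le)
    simp [transvection, Matrix.single_apply, this, Matrix.one_apply, hab.ne]
  · intro a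
    have : ¬ (i = a ∧ j = a) := by rintro ⟨rfl, rfl⟩; exact absurd h (lt_irrefl _)
    simp [transvection, Matrix.single_apply, this]

/-- conjugating by the simple reflection -/
theorem conj_swap {k : ℕ} (j : ℕ) (hj : j + 1 < k) (b : Mat k k) (hb : b ∈ Bp k)
    (h0 : b ⟨j, by omega⟩ ⟨j + 1, hj⟩ = 0) :
    permMat k (Equiv.swap ⟨j, by omega⟩ ⟨j + 1, hj⟩) * b *
      permMat k (Equiv.swap ⟨j, by omega⟩ ⟨j + 1, hj⟩) ∈ Bp k := by
  refine ⟨((perm_unit _).mul hb.1).mul (perm_unit _), ?_⟩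
  intro a c hac
  rw [mul_perm_apply, perm_mul_apply, Equiv.swap_inv]
  by_cases h : a = ⟨j + 1, hj⟩ ∧ c = ⟨j, by omega⟩
  · rw [h.1, h.2, Equiv.swap_apply_left, Equiv.swap_apply_right, h0]
  · apply hb.2
    rw [Equiv.swap_apply_def, Equiv.swap_apply_def]
    simp only [Fin.ext_iff, Fin.lt_def] at *
    split_ifs <;> simp <;> omega

/-- B w B s B = B ws B when ws > w -/
theorem mul_swap_mem {k : ℕ} (w : Equiv.Perm (Fin k)) (j : ℕ) (hj : j + 1 < k)
    (hw : w ⟨j, by omega⟩ < w ⟨j + 1, hj⟩) (g : Mat k k) (hg : g ∈ dcPlus (permMat k w)) :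
    g * permMat k (Equiv.swap ⟨j, by omega⟩ ⟨j + 1, hj⟩) ∈
      dcPlus (permMat k (w * Equiv.swap ⟨j, by omega⟩ ⟨j + 1, hj⟩)) := by
  obtain ⟨b1, hb1, b, hb, rfl⟩ := hg
  set J : Fin k := ⟨j, by omega⟩ with hJ
  set J' : Fin k := ⟨j + 1, hj⟩ with hJ'
  have hlt : J < J' := by simp [hJ, hJ', Fin.lt_def]
  have hd := Bp_diag hb J'
  set μ : ℂ := b J J' / b J' J' with hμ
  set b' := transvection J J' (-μ) * b with hb'
  have hb'B : b' ∈ Bp k := Bp_mul (transvection_Bp hlt _) hb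
  have hb0 : b' J J' = 0 := by
    simp only [hb', transvection, add_mul, one_mul, Matrix.add_apply, Matrix.single_mul_apply_same]
    rw [hμ]; field_simp; ring
  have hbb : b = transvection J J' μ * b' := by
    rw [hb', ← Matrix.mul_assoc, Matrix.transvection_mul_transvection_same _ _ hlt.ne]
    simp
  have hc := conj_swap j hj b' hb'B hb0
  refine ⟨b1 * transvection (w J) (w J') μ, Bp_mul hb1 (transvection_Bp hw _), _, hc, ?_⟩
  have hss : permMat k (Equiv.swap J J') * permMat k (Equiv.swap J J') = 1 := by
    rw [← perm_mul, Equiv.swap_mul_self, perm_one]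
  rw [perm_mul]
  calc b1 * permMat k w * b * permMat k (Equiv.swap J J')
      = b1 * (permMat k w * transvection J J' μ) * b' * permMat k (Equiv.swap J J') := by
        conv_lhs => rw [hbb]
        simp only [Matrix.mul_assoc]
    _ = b1 * (transvection (w J) (w J') μ * permMat k w) *
          (permMat k (Equiv.swap J J') * permMat k (Equiv.swap J J')) * b' *
            permMat k (Equiv.swap J J') := by
        rw [perm_mul_transvection, hss, Matrix.mul_one]
    _ = _ := by simp only [Matrix.mul_assoc]; rfl

theorem transvection_factor {k : ℕ} (J J' : Fin k) (h : J < J') :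
    ∃ D ∈ Bp k, transvection J' J (1 : ℂ) =
      transvection J J' 1 * permMat k (Equiv.swap J J') * D := by
  refine ⟨Matrix.of fun a b => if a = J' ∧ b = J' then -1 else if a = J ∧ b = J' then 1 else
    if a = b then 1 else 0, ?_, ?_⟩
  · apply Bp_of_diag
    · intro a b hab
      have h1 : ¬ (a = J' ∧ b = J') := by rintro ⟨rfl, rfl⟩; exact lt_irrefl _ hab
      have h2 : ¬ (a = J ∧ b = J') := by rintro ⟨rfl, rfl⟩; exact absurd h (not_lt.2 hab.le)
      simp [h1, h2, hab.ne']
    · intro a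
      have h2 : ¬ (a = J ∧ a = J') := by rintro ⟨rfl, rfl⟩; exact lt_irrefl _ h
      by_cases h1 : a = J' <;> simp [h1, h2, h.ne']
  · have hne := h.ne
    rw [Matrix.mul_assoc]
    ext a b
    rw [transvection, transvection, add_mul, one_mul, Matrix.add_apply, Matrix.add_apply,
      perm_mul_apply, Equiv.swap_inv]
    by_cases ha : a = J
    · subst ha
      rw [Matrix.single_mul_apply_same, perm_mul_apply, Equiv.swap_inv]
      simp only [Equiv.swap_apply_left, Equiv.swap_apply_right, Matrix.one_apply,
        Matrix.single_apply]
      by_cases hb : b = J'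
      · subst hb; simp [hne, hne.symm]
      · by_cases hb' : b = a
        · subst hb'; simp [hne, hne.symm]
        · simp [hne, hne.symm, hb, hb', Ne.symm hb, Ne.symm hb']
    · rw [Matrix.single_mul_apply_of_ne _ _ _ _ _ ha]
      by_cases ha' : a = J'
      · subst ha'
        simp only [Equiv.swap_apply_right, Matrix.one_apply, Matrix.single_apply]
        by_cases hb : b = a
        · subst hb; simp [hne]
        · by_cases hb' : b = J
          · subst hb'; simp [hne, hne.symm]
          · simp [hne, hb, hb', Ne.symm hb, Ne.symm hb']
      · rw [Equiv.swap_apply_of_ne_of_ne ha ha']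
        simp [Matrix.one_apply, Matrix.single_apply, ha, ha', Ne.symm ha']

theorem sum_swap_lt {k : ℕ} (y : Equiv.Perm (Fin k)) (j : ℕ) (hj : j + 1 < k)
    (h : y ⟨j + 1, hj⟩ < y ⟨j, by omega⟩) :
    ∑ i : Fin k, (k - (i:ℕ)) * ((y * Equiv.swap (⟨j, by omega⟩ : Fin k) ⟨j + 1, hj⟩ : Equiv.Perm (Fin k)) i : ℕ) <
      ∑ i : Fin k, (k - (i:ℕ)) * (y i : ℕ) := by
  set J : Fin k := ⟨j, by omega⟩ with hJ
  set J' : Fin k := ⟨j + 1, hj⟩ with hJ'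
  have hne : J' ≠ J := by simp [hJ, hJ']
  have hm : J' ∈ Finset.univ.erase J := by simp [hne]
  rw [← Finset.add_sum_erase _ _ (Finset.mem_univ J), ← Finset.add_sum_erase _ _ hm]
  conv_rhs => rw [← Finset.add_sum_erase _ _ (Finset.mem_univ J), ← Finset.add_sum_erase _ _ hm]
  have : ∑ x ∈ (Finset.univ.erase J).erase J', (k - (x:ℕ)) * ((y * Equiv.swap J J') x : ℕ) =
      ∑ x ∈ (Finset.univ.erase J).erase J', (k - (x:ℕ)) * (y x : ℕ) := by
    apply Finset.sum_congr rfl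
    intro x hx
    simp only [Finset.mem_erase] at hx
    rw [Equiv.Perm.mul_apply, Equiv.swap_apply_of_ne_of_ne hx.2.1 hx.1]
  rw [this, Equiv.Perm.mul_apply, Equiv.Perm.mul_apply, Equiv.swap_apply_left,
    Equiv.swap_apply_right]
  rw [Fin.lt_def] at h
  have e1 : k - (J:ℕ) = (k - (J':ℕ)) + 1 := by simp [hJ, hJ']; omega
  rw [e1]
  nlinarith

theorem exists_rich {k : ℕ} (N : ℕ) : ∀ (y z : Equiv.Perm (Fin k)),
    (∑ i : Fin k, (k - (i:ℕ)) * (y i : ℕ)) ≤ N → bruhatLE z y →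
    ∃ g ∈ dcPlus (permMat k y), ∃ b ∈ Bm k, g = b * permMat k z := by
  induction N using Nat.strong_induction_on with
  | _ N ih =>
  intro y z hN hzy
  by_cases hdesc : ∃ (j : ℕ) (hj : j + 1 < k), y ⟨j + 1, hj⟩ < y ⟨j, by omega⟩
  · obtain ⟨j, hj, hd⟩ := hdesc
    have hlt := sum_swap_lt y j hj hd
    have hys : (y * Equiv.swap (⟨j, by omega⟩ : Fin k) ⟨j + 1, hj⟩ : Equiv.Perm (Fin k)) ⟨j, by omega⟩ <
        (y * Equiv.swap (⟨j, by omega⟩ : Fin k) ⟨j + 1, hj⟩ : Equiv.Perm (Fin k)) ⟨j + 1, hj⟩ := by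
      rw [Equiv.Perm.mul_apply, Equiv.Perm.mul_apply, Equiv.swap_apply_left,
        Equiv.swap_apply_right]; exact hd
    have hyss : y * Equiv.swap (⟨j, by omega⟩ : Fin k) ⟨j + 1, hj⟩ *
        Equiv.swap ⟨j, by omega⟩ ⟨j + 1, hj⟩ = y := by
      rw [mul_assoc, Equiv.swap_mul_self, mul_one]
    rcases lt_or_ge (z ⟨j, by omega⟩) (z ⟨j + 1, hj⟩) with hz | hz
    · have hl := lifting y z z j hj hz (Or.inl rfl) hzy
      obtain ⟨g, hg, c, hc, e⟩ := ih _ (lt_of_lt_of_le hlt hN) _ _ le_rfl hl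
      have hJ : (⟨j, by omega⟩ : Fin k) < ⟨j + 1, hj⟩ := by simp [Fin.lt_def]
      refine ⟨g * transvection ⟨j + 1, hj⟩ ⟨j, by omega⟩ 1, ?_,
        c * transvection (z ⟨j + 1, hj⟩) (z ⟨j, by omega⟩) 1,
        Bm_mul hc (transvection_Bm hz _), ?_⟩
      · obtain ⟨D, hD, eD⟩ := transvection_factor _ _ hJ
        rw [eD, ← Matrix.mul_assoc, ← Matrix.mul_assoc]
        apply dcPlus_mul_right _ hD
        have := mul_swap_mem _ j hj hys _ (dcPlus_mul_right hg (transvection_Bp hJ 1))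
        rwa [hyss] at this
      · rw [e, Matrix.mul_assoc, perm_mul_transvection, Matrix.mul_assoc]
    · have hz' : z ⟨j + 1, hj⟩ < z ⟨j, by omega⟩ :=
        lt_of_le_of_ne hz fun h => by simpa using z.injective h
      have hzss : z * Equiv.swap (⟨j, by omega⟩ : Fin k) ⟨j + 1, hj⟩ *
          Equiv.swap ⟨j, by omega⟩ ⟨j + 1, hj⟩ = z := by
        rw [mul_assoc, Equiv.swap_mul_self, mul_one]
      have hl := lifting y z (z * Equiv.swap (⟨j, Nat.lt_of_succ_lt hj⟩ : Fin k) ⟨j + 1, hj⟩) j hj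
        (by rw [Equiv.Perm.mul_apply, Equiv.Perm.mul_apply, Equiv.swap_apply_left,
              Equiv.swap_apply_right]; exact hz') (Or.inr hzss.symm) hzy
      obtain ⟨g, hg, c, hc, e⟩ := ih _ (lt_of_lt_of_le hlt hN) _ _ le_rfl hl
      have := mul_swap_mem _ j hj hys _ hg
      rw [hyss] at this
      refine ⟨_, this, c, hc, ?_⟩
      rw [e, Matrix.mul_assoc, ← perm_mul, hzss]
  · push Not at hdesc
    have hmono : ∀ (w : Equiv.Perm (Fin k)), Monotone w → w = 1 := by
      intro w hw
      have hs : StrictMono w := hw.strictMono_of_injective w.injective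
      let o : Fin k ≃o Fin k := StrictMono.orderIsoOfSurjective w hs w.surjective
      have ho : o = OrderIso.refl _ := Subsingleton.elim _ _
      ext i
      have : o i = i := by rw [ho]; rfl
      exact congrArg Fin.val this
    have hy1 : y = 1 := by
      apply hmono
      cases k with
      | zero => intro a; exact a.elim0
      | succ k =>
        rw [Fin.monotone_iff_le_succ]
        intro i
        exact hdesc i.1 (by omega)
    subst hy1
    have hz1 : z = 1 := by
      rw [bruhat_iff] at hzy
      have key : ∀ p, p ≤ k → ∀ i : Fin k, (i:ℕ) < p → (z i : ℕ) < p := by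
        intro p hp
        have h1 := hzy p p
        have h2 : cnt (1 : Equiv.Perm (Fin k)) p p =
            (Finset.univ.filter fun i : Fin k => (i : ℕ) < p).card := by
          unfold cnt; congr 1; ext i; simp
        rw [h2] at h1
        have hsub : (Finset.univ.filter fun i : Fin k => (i : ℕ) < p ∧ (z i : ℕ) < p) ⊆
            (Finset.univ.filter fun i : Fin k => (i : ℕ) < p) := by
          intro i; simp only [Finset.mem_filter]; tauto
        have := Finset.eq_of_subset_of_card_le hsub h1
        intro i hi
        have hi' : i ∈ (Finset.univ.filter fun i : Fin k => (i : ℕ) < p) := by simpa using hi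
        rw [← this] at hi'
        simp only [Finset.mem_filter] at hi'
        exact hi'.2.2
      have hle : ∀ i, z i ≤ i := by
        intro i
        have := key (i + 1) i.2 i (Nat.lt_succ_self _)
        rw [Fin.le_def]; omega
      ext i
      have hsum : ∑ i, (z i : ℕ) = ∑ i : Fin k, (i : ℕ) := Equiv.sum_comp z (fun i : Fin k => (i:ℕ))
      exact (Finset.sum_eq_sum_iff_of_le (fun i _ => Fin.le_def.1 (hle i))).1 hsum i (Finset.mem_univ i)
    subst hz1
    exact ⟨permMat k 1, ⟨1, Bp_one k, 1, Bp_one k, by simp⟩, 1, Bm_one k, by simp⟩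

/-! ### Blocks -/

def blk {t s r : ℕ} (A : Mat t t) (B : Mat t r) (C : Mat s t) (D : Mat s r) : Mat (t + s) (t + r) :=
  (Matrix.fromBlocks A B C D).submatrix finSumFinEquiv.symm finSumFinEquiv.symm

section
variable {t s r q : ℕ}

@[simp] theorem blk_ll (A : Mat t t) (B : Mat t r) (C : Mat s t) (D : Mat s r) (i j) :
    blk A B C D (Fin.castAdd s i) (Fin.castAdd r j) = A i j := by simp [blk]
@[simp] theorem blk_lr (A : Mat t t) (B : Mat t r) (C : Mat s t) (D : Mat s r) (i j) :
    blk A B C D (Fin.castAdd s i) (Fin.natAdd t j) = B i j := by simp [blk]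
@[simp] theorem blk_rl (A : Mat t t) (B : Mat t r) (C : Mat s t) (D : Mat s r) (i j) :
    blk A B C D (Fin.natAdd t i) (Fin.castAdd r j) = C i j := by simp [blk]
@[simp] theorem blk_rr (A : Mat t t) (B : Mat t r) (C : Mat s t) (D : Mat s r) (i j) :
    blk A B C D (Fin.natAdd t i) (Fin.natAdd t j) = D i j := by simp [blk]

theorem blk_ext {M N : Mat (t + s) (t + r)}
    (h1 : ∀ i j, M (Fin.castAdd s i) (Fin.castAdd r j) = N (Fin.castAdd s i) (Fin.castAdd r j))
    (h2 : ∀ i j, M (Fin.castAdd s i) (Fin.natAdd t j) = N (Fin.castAdd s i) (Fin.natAdd t j))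
    (h3 : ∀ i j, M (Fin.natAdd t i) (Fin.castAdd r j) = N (Fin.natAdd t i) (Fin.castAdd r j))
    (h4 : ∀ i j, M (Fin.natAdd t i) (Fin.natAdd t j) = N (Fin.natAdd t i) (Fin.natAdd t j)) :
    M = N := by
  ext i j
  refine Fin.addCases (fun i => ?_) (fun i => ?_) i <;>
  refine Fin.addCases (fun j => ?_) (fun j => ?_) j
  · exact h1 i j
  · exact h2 i j
  · exact h3 i j
  · exact h4 i j

theorem blk_inj {A A' : Mat t t} {B B' : Mat t r} {C C' : Mat s t} {D D' : Mat s r}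
    (h : blk A B C D = blk A' B' C' D') : A = A' ∧ B = B' ∧ C = C' ∧ D = D' := by
  refine ⟨?_, ?_, ?_, ?_⟩ <;> ext i j
  · simpa using congrFun (congrFun h (Fin.castAdd s i)) (Fin.castAdd r j)
  · simpa using congrFun (congrFun h (Fin.castAdd s i)) (Fin.natAdd t j)
  · simpa using congrFun (congrFun h (Fin.natAdd t i)) (Fin.castAdd r j)
  · simpa using congrFun (congrFun h (Fin.natAdd t i)) (Fin.natAdd t j)

theorem exists_blk (M : Mat (t + s) (t + r)) : ∃ A B C D, M = blk A B C D :=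
  ⟨Matrix.of fun i j => M (Fin.castAdd s i) (Fin.castAdd r j),
   Matrix.of fun i j => M (Fin.castAdd s i) (Fin.natAdd t j),
   Matrix.of fun i j => M (Fin.natAdd t i) (Fin.castAdd r j),
   Matrix.of fun i j => M (Fin.natAdd t i) (Fin.natAdd t j),
   blk_ext (by simp) (by simp) (by simp) (by simp)⟩

theorem blk_mul (A : Mat t t) (B : Mat t r) (C : Mat s t) (D : Mat s r)
    (A' : Mat t t) (B' : Mat t q) (C' : Mat r t) (D' : Mat r q) :
    blk A B C D * blk A' B' C' D' =
      blk (A * A' + B * C') (A * B' + B * D') (C * A' + D * C') (C * B' + D * D') := by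
  rw [blk, blk, Matrix.submatrix_mul_equiv, Matrix.fromBlocks_multiply]; rfl

theorem blk_T (A : Mat t t) (B : Mat t r) (C : Mat s t) (D : Mat s r) :
    (blk A B C D)ᵀ = blk Aᵀ Cᵀ Bᵀ Dᵀ := by
  rw [blk, Matrix.transpose_submatrix, Matrix.fromBlocks_transpose]; rfl

theorem blk_unit {A : Mat t t} {B : Mat t s} {D : Mat s s} :
    IsUnit (blk A B 0 D) ↔ IsUnit A ∧ IsUnit D := by
  rw [Matrix.isUnit_iff_isUnit_det, blk, Matrix.det_submatrix_equiv_self,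
    Matrix.det_fromBlocks_zero₂₁, IsUnit.mul_iff, ← Matrix.isUnit_iff_isUnit_det,
    ← Matrix.isUnit_iff_isUnit_det]

theorem blk_Bp {A : Mat t t} {B : Mat t s} {C : Mat s t} {D : Mat s s} :
    blk A B C D ∈ Bp (t + s) ↔ C = 0 ∧ A ∈ Bp t ∧ D ∈ Bp s := by
  constructor
  · intro h
    have hC : C = 0 := by
      ext i j
      have := h.2 (Fin.natAdd t i) (Fin.castAdd s j) (by rw [Fin.lt_def]; simp; omega)
      simpa using this
    subst hC
    have hu := blk_unit.1 h.1
    refine ⟨rfl, ⟨hu.1, fun i j hij => ?_⟩, ⟨hu.2, fun i j hij => ?_⟩⟩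
    · simpa using h.2 (Fin.castAdd s i) (Fin.castAdd s j) hij
    · simpa using h.2 (Fin.natAdd t i) (Fin.natAdd t j) (Nat.add_lt_add_left hij t)
  · rintro ⟨rfl, hA, hD⟩
    refine ⟨blk_unit.2 ⟨hA.1, hD.1⟩, fun i j => ?_⟩
    refine Fin.addCases (fun i => ?_) (fun i => ?_) i <;>
    refine Fin.addCases (fun j => ?_) (fun j => ?_) j <;> intro hij
    · simpa using hA.2 i j hij
    · rw [Fin.lt_def] at hij; simp at hij; omega
    · simp
    · simpa using hD.2 i j (Nat.lt_of_add_lt_add_left hij)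

theorem Imn_blk : Imn (t + s) (t + r) t = blk 1 0 0 0 := by
  apply blk_ext <;> intro i j
  · simp [Imn, Matrix.one_apply, Fin.ext_iff]
  · simp [Imn]; omega
  · simp [Imn]
  · simp [Imn]

theorem Imn_T : (Imn (t + s) (t + r) t)ᵀ = Imn (t + r) (t + s) t := by
  rw [Imn_blk, Imn_blk, blk_T]; simp

theorem embPerm_castAdd (h : t ≤ t + s) (τ : Equiv.Perm (Fin t)) (i : Fin t) :
    embPerm h τ (Fin.castAdd s i) = Fin.castAdd s (τ i) := by
  exact Equiv.Perm.viaFintypeEmbedding_apply_image τ (Fin.castLEEmb h) i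

theorem embPerm_natAdd (h : t ≤ t + s) (τ : Equiv.Perm (Fin t)) (i : Fin s) :
    embPerm h τ (Fin.natAdd t i) = Fin.natAdd t i := by
  apply Equiv.Perm.viaFintypeEmbedding_apply_notMem_range
  rintro ⟨a, ha⟩
  have := congrArg Fin.val ha
  simp at this
  omega

theorem embPerm_blk (h : t ≤ t + s) (τ : Equiv.Perm (Fin t)) :
    permMat (t + s) (embPerm h τ) = blk (permMat t τ) 0 0 1 := by
  apply blk_ext <;> intro i j
  · simp [permMat, embPerm_castAdd]
  · simp [permMat, embPerm_natAdd, Fin.ext_iff]; omega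
  · simp [permMat, embPerm_castAdd, Fin.ext_iff]; omega
  · simp [permMat, embPerm_natAdd, Matrix.one_apply]

theorem embPerm_inv (h : t ≤ t + s) (τ : Equiv.Perm (Fin t)) :
    (embPerm h τ)⁻¹ = embPerm h τ⁻¹ := by
  rw [inv_eq_iff_mul_eq_one]
  ext i
  congr 1
  refine Fin.addCases (fun i => ?_) (fun i => ?_) i
  · simp [embPerm_castAdd]
  · simp [embPerm_natAdd]

def tailPerm (ρ : Equiv.Perm (Fin s)) : Equiv.Perm (Fin (t + s)) :=
  finSumFinEquiv.permCongr (Equiv.sumCongr 1 ρ)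

theorem tailPerm_castAdd (ρ : Equiv.Perm (Fin s)) (i : Fin t) :
    (tailPerm ρ : Equiv.Perm (Fin (t + s))) (Fin.castAdd s i) = Fin.castAdd s i := by
  simp [tailPerm, Equiv.permCongr_apply]

theorem tailPerm_natAdd (ρ : Equiv.Perm (Fin s)) (i : Fin s) :
    (tailPerm ρ : Equiv.Perm (Fin (t + s))) (Fin.natAdd t i) = Fin.natAdd t (ρ i) := by
  simp [tailPerm, Equiv.permCongr_apply]

theorem tailPerm_fix (ρ : Equiv.Perm (Fin s)) (i : Fin (t + s)) (h : (i : ℕ) < t) :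
    (tailPerm ρ : Equiv.Perm (Fin (t + s))) i = i := by
  have : i = Fin.castAdd s ⟨i, h⟩ := rfl
  rw [this, tailPerm_castAdd]

theorem tailPerm_blk (ρ : Equiv.Perm (Fin s)) :
    permMat (t + s) (tailPerm ρ) = blk 1 0 0 (permMat s ρ) := by
  apply blk_ext <;> intro i j
  · simp [permMat, tailPerm_castAdd, Matrix.one_apply]
  · simp [permMat, tailPerm_natAdd, Fin.ext_iff]; omega
  · simp [permMat, tailPerm_castAdd, Fin.ext_iff]; omega
  · simp [permMat, tailPerm_natAdd]

theorem blk_one : blk (1 : Mat t t) 0 0 (1 : Mat s s) = 1 := by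
  apply blk_ext <;> intro i j
  · simp [Matrix.one_apply]
  · simp [Matrix.one_apply, Fin.ext_iff]; omega
  · simp [Matrix.one_apply, Fin.ext_iff]; omega
  · simp [Matrix.one_apply]

theorem perm_mul_Imn (σ : Equiv.Perm (Fin (t + s))) (h : ∀ i : Fin (t + s), (i:ℕ) < t → σ i = i) :
    permMat (t + s) σ * Imn (t + s) (t + r) t = Imn (t + s) (t + r) t := by
  ext i j
  rw [perm_mul_apply]
  by_cases hi : (i:ℕ) < t
  · have : σ⁻¹ i = i := by rw [Equiv.Perm.inv_eq_iff_eq, h i hi]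
    rw [this]
  · have : ¬ ((σ⁻¹ i : Fin (t+s)) : ℕ) < t := by
      intro hlt
      have h2 := h _ hlt
      have h3 : σ (σ⁻¹ i) = i := by simp
      rw [h3] at h2
      rw [← h2] at hlt
      exact hi hlt
    simp only [Imn, hi, this, and_false, if_false]

theorem Imn_mul_perm (σ : Equiv.Perm (Fin (t + r))) (h : ∀ i : Fin (t + r), (i:ℕ) < t → σ i = i) :
    Imn (t + s) (t + r) t * permMat (t + r) σ = Imn (t + s) (t + r) t := by
  have h1 := perm_mul_Imn (r := s) σ⁻¹ (fun i hi => by rw [Equiv.Perm.inv_eq_iff_eq, h i hi])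
  have := congrArg Matrix.transpose h1
  rw [Matrix.transpose_mul, Imn_T, perm_T, inv_inv] at this
  exact this

theorem emb_conj (h : t ≤ t + s) (h' : t ≤ t + r) (τ : Equiv.Perm (Fin t)) :
    permMat (t + s) (embPerm h τ) * Imn (t + s) (t + r) t * permMat (t + r) (embPerm h' τ)⁻¹ =
      Imn (t + s) (t + r) t := by
  rw [embPerm_inv, embPerm_blk, embPerm_blk, Imn_blk, blk_mul, blk_mul]
  simp [perm_mul_inv]

theorem conj_Bp (v : Equiv.Perm (Fin (t + s))) (h1 : headMono t v) (h2 : tailMono t v)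
    {A : Mat t t} {D : Mat s s} (hA : A ∈ Bp t) (hD : D ∈ Bp s) :
    permMat (t + s) v * blk A 0 0 D * permMat (t + s) v⁻¹ ∈ Bp (t + s) := by
  refine ⟨((perm_unit _).mul (blk_unit.2 ⟨hA.1, hD.1⟩)).mul (perm_unit _), ?_⟩
  intro i j hij
  rw [mul_perm_apply, perm_mul_apply]
  obtain ⟨i, rfl⟩ := v.surjective i
  obtain ⟨j, rfl⟩ := v.surjective j
  have e : ∀ i, v⁻¹ (v i) = i := fun i => by simp
  rw [e, e]
  revert hij
  refine Fin.addCases (fun i => ?_) (fun i => ?_) i <;>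
  refine Fin.addCases (fun j => ?_) (fun j => ?_) j <;> intro hij
  · rw [blk_ll]
    apply hA.2
    by_contra hcon
    rcases (not_lt.1 hcon).lt_or_eq with h | h
    · exact absurd (h1 (Fin.castAdd s i) (Fin.castAdd s j) h (by simp))
        (not_lt.2 hij.le)
    · subst h; exact lt_irrefl _ hij
  · simp
  · simp
  · rw [blk_rr]
    apply hD.2
    by_contra hcon
    rcases (not_lt.1 hcon).lt_or_eq with h | h
    · exact absurd (h2 (Fin.natAdd t i) (Fin.natAdd t j) (Nat.add_lt_add_left h t) (by simp))
        (not_lt.2 hij.le)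
    · subst h; exact lt_irrefl _ hij

theorem conj_Bm (v : Equiv.Perm (Fin (t + s))) (h1 : headMono t v) (h2 : tailMono t v)
    {A : Mat t t} {D : Mat s s} (hA : A ∈ Bm t) (hD : D ∈ Bm s) :
    permMat (t + s) v * blk A 0 0 D * permMat (t + s) v⁻¹ ∈ Bm (t + s) := by
  rw [Bm_iff] at *
  have := conj_Bp v h1 h2 hA hD
  rw [Matrix.transpose_mul, Matrix.transpose_mul, perm_T, perm_T, blk_T, inv_inv]
  simpa [Matrix.mul_assoc] using this

/-- easy inclusion -/
theorem mem_dcPlus_of (h' : t ≤ t + r) (y : Equiv.Perm (Fin (t + s))) (v τ₂ : Equiv.Perm (Fin (t + r)))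
    (h1 : headMono t v) (h2 : tailMono t v) (hτ₂ : ∀ i : Fin (t + r), (i:ℕ) < t → τ₂ i = i)
    (τ : Equiv.Perm (Fin t)) (g : Mat (t + s) (t + s)) (f : Mat (t + r) (t + r))
    (hg : g ∈ dcPlus (permMat _ y))
    (hf : ∃ b ∈ Bm (t + r), f = b * permMat _ (v * τ₂ * (embPerm h' τ)⁻¹)) :
    g * Imn (t + s) (t + r) t * permMat _ (embPerm h' τ)⁻¹ * fᵀ ∈
      dcPlus (permMat _ y * Imn (t + s) (t + r) t * permMat _ v⁻¹) := by
  obtain ⟨b1, hb1, b2, hb2, rfl⟩ := hg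
  obtain ⟨b, hb, rfl⟩ := hf
  obtain ⟨A, B, C, D, rfl⟩ := exists_blk b2
  obtain ⟨rfl, hA, hD⟩ := blk_Bp.1 hb2
  rw [Bm_iff] at hb
  refine ⟨b1, hb1, _, Bp_mul (conj_Bp v h1 h2 hA (Bp_one r)) hb, ?_⟩
  have e1 : blk A B 0 D * Imn (t + s) (t + r) t = Imn (t + s) (t + r) t * blk A 0 0 (1 : Mat r r) := by
    rw [Imn_blk, blk_mul, blk_mul]; simp
  have e2 : Imn (t + s) (t + r) t * permMat _ τ₂⁻¹ = Imn (t + s) (t + r) t :=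
    Imn_mul_perm _ (fun i hi => by rw [Equiv.Perm.inv_eq_iff_eq, hτ₂ i hi])
  have e3 : permMat _ (embPerm h' τ)⁻¹ * (b * permMat _ (v * τ₂ * (embPerm h' τ)⁻¹))ᵀ =
      permMat _ τ₂⁻¹ * (permMat _ v⁻¹ * bᵀ) := by
    rw [Matrix.transpose_mul, perm_T, ← Matrix.mul_assoc, ← Matrix.mul_assoc, ← perm_mul, ← perm_mul]
    congr 2
    group
  calc b1 * permMat _ y * blk A B 0 D * Imn (t + s) (t + r) t * permMat _ (embPerm h' τ)⁻¹ *
        (b * permMat _ (v * τ₂ * (embPerm h' τ)⁻¹))ᵀ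
      = b1 * permMat _ y * (blk A B 0 D * (Imn (t + s) (t + r) t * permMat _ τ₂⁻¹)) *
          (permMat _ v⁻¹ * bᵀ) := by
        rw [Matrix.mul_assoc _ (permMat _ (embPerm h' τ)⁻¹), e3]; simp only [Matrix.mul_assoc]
    _ = b1 * permMat _ y * (Imn (t + s) (t + r) t * blk A 0 0 (1 : Mat r r)) * (permMat _ v⁻¹ * bᵀ) := by
        rw [e2, e1]
    _ = b1 * permMat _ y * (Imn (t + s) (t + r) t * ((permMat _ v⁻¹ * permMat _ v) * blk A 0 0 (1 : Mat r r))) *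
          (permMat _ v⁻¹ * bᵀ) := by
        rw [perm_inv_mul, Matrix.one_mul]
    _ = _ := by simp only [Matrix.mul_assoc]

/-- parabolic LPU -/
theorem par_factor (h : t ≤ t + s) {A1 : Mat t t} {A2 : Mat t s} {A4 : Mat s s} (hA4 : IsUnit A4)
    {L U : Mat t t} {τ : Equiv.Perm (Fin t)} (hL : L ∈ Bm t) (hU : U ∈ Bp t)
    (e : A1 = L * permMat t τ * U) :
    ∃ L2 ∈ Bm s, ∃ ρ : Equiv.Perm (Fin s), ∃ X : Mat t s, ∃ U2 ∈ Bp s,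
      blk A1 A2 0 A4 = blk L 0 0 L2 * permMat (t + s) (tailPerm ρ * embPerm h τ) * blk U X 0 U2 := by
  obtain ⟨L2, hL2, ρ, U2, hU2, e4⟩ := lpu A4 hA4
  refine ⟨L2, hL2, ρ, (L * permMat t τ)⁻¹ * A2, U2, hU2, ?_⟩
  have hu : IsUnit (L * permMat t τ) := hL.1.mul (perm_unit τ)
  rw [perm_mul, tailPerm_blk, embPerm_blk, blk_mul, blk_mul, blk_mul]
  simp [← e, e4, Matrix.mul_nonsing_inv_cancel_left _ _ (unit_det hu)]

end

/-! ### Main argument -/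

def RI {k : ℕ} (y z : Equiv.Perm (Fin k)) : Set (Mat k k) :=
  {g | g ∈ dcPlus (permMat k y) ∧ ∃ b ∈ Bm k, g = b * permMat k z}

theorem dcMinus_T {k l : ℕ} {w x : Mat k l} : x ∈ dcMinus w ↔ xᵀ ∈ dcPlus wᵀ := by
  constructor
  · rintro ⟨b, hb, b', hb', rfl⟩
    exact ⟨b'ᵀ, Bm_iff.1 hb', bᵀ, Bm_iff.1 hb, by simp [Matrix.mul_assoc]⟩
  · rintro ⟨b, hb, b', hb', e⟩
    refine ⟨b'ᵀ, by rw [Bm_iff]; simpa using hb', bᵀ, by rw [Bm_iff]; simpa using hb, ?_⟩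
    have := congrArg Matrix.transpose e
    simpa [Matrix.mul_assoc] using this

theorem Pt_iff {m n t : ℕ} (htm : t ≤ m) (htn : t ≤ n)
    (y : Equiv.Perm (Fin m)) (v : Equiv.Perm (Fin n))
    (z : Equiv.Perm (Fin m)) (u : Equiv.Perm (Fin n)) (x : Mat m n) :
    x ∈ Pt m n t htm htn y v z u ↔ ∃ τ : Equiv.Perm (Fin t),
      bruhatLE (z * embPerm htm τ) y ∧ bruhatLE (v * (embPerm htn τ)⁻¹) u ∧
      ∃ g ∈ RI y (z * embPerm htm τ), ∃ f ∈ RI u (v * (embPerm htn τ)⁻¹),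
        x = g * Imn m n t * permMat n (embPerm htn τ)⁻¹ * fᵀ := by
  constructor
  · rintro ⟨τ, h1, h2, g, hg, h, ⟨⟨c, hc, hh⟩, ⟨b, hb, hh'⟩⟩, rfl⟩
    refine ⟨τ, h1, h2, g, hg, cᵀ, ⟨?_, bᵀ, ?_, ?_⟩, ?_⟩
    · have := dcMinus_T.1 hc
      rwa [perm_T, inv_inv] at this
    · rw [Bm_iff]; simpa using hb
    · have e : c = permMat n (embPerm htn τ) * (permMat n v⁻¹ * b) := by
        rw [← hh', hh, ← Matrix.mul_assoc, perm_mul_inv, Matrix.one_mul]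
      rw [e, Matrix.transpose_mul, Matrix.transpose_mul, perm_T, perm_T, inv_inv, perm_mul,
        Matrix.mul_assoc]
    · rw [hh, Matrix.transpose_transpose]; simp only [Matrix.mul_assoc]
  · rintro ⟨τ, h1, h2, g, hg, f, ⟨hf, b, hb, hfb⟩, rfl⟩
    refine ⟨τ, h1, h2, g, hg, permMat n (embPerm htn τ)⁻¹ * fᵀ,
      ⟨⟨fᵀ, ?_, rfl⟩, ⟨bᵀ, Bm_iff.1 hb, ?_⟩⟩, by simp only [Matrix.mul_assoc]⟩
    · rw [dcMinus_T, perm_T, inv_inv]; simpa using hf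
    · rw [hfb, Matrix.transpose_mul, perm_T, ← Matrix.mul_assoc, ← perm_mul]
      congr 2
      group

section
variable {t s r : ℕ}

theorem Imn_emb_comm (h : t ≤ t + s) (h' : t ≤ t + r) (τ : Equiv.Perm (Fin t)) :
    Imn (t + s) (t + r) t * permMat (t + r) (embPerm h' τ) =
      permMat (t + s) (embPerm h τ) * Imn (t + s) (t + r) t := by
  rw [embPerm_blk, embPerm_blk, Imn_blk, blk_mul, blk_mul]
  simp

theorem mem_inter_of (h : t ≤ t + s) (h' : t ≤ t + r)
    {y z : Equiv.Perm (Fin (t + s))} {u v : Equiv.Perm (Fin (t + r))}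
    (hv1 : headMono t v) (hv2 : tailMono t v) (hz1 : headMono t z) (hz2 : tailMono t z)
    {τ₁ : Equiv.Perm (Fin (t + s))} {τ₂ : Equiv.Perm (Fin (t + r))}
    (hτ₁ : ∀ i : Fin (t + s), (i:ℕ) < t → τ₁ i = i)
    (hτ₂ : ∀ i : Fin (t + r), (i:ℕ) < t → τ₂ i = i)
    (τ : Equiv.Perm (Fin t)) {g : Mat (t + s) (t + s)} {f : Mat (t + r) (t + r)}
    (hg : g ∈ RI y (z * τ₁ * embPerm h τ)) (hf : f ∈ RI u (v * τ₂ * (embPerm h' τ)⁻¹)) :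
    g * Imn (t + s) (t + r) t * permMat _ (embPerm h' τ)⁻¹ * fᵀ ∈
      dcPlus (permMat _ y * Imn (t + s) (t + r) t * permMat _ v⁻¹) ∩
      dcMinus (permMat _ z * Imn (t + s) (t + r) t * permMat _ u⁻¹) := by
  refine ⟨mem_dcPlus_of h' y v τ₂ hv1 hv2 hτ₂ τ g f hg.1 hf.2, ?_⟩
  rw [dcMinus_T]
  have e := mem_dcPlus_of (s := r) (r := s) h u z τ₁ hz1 hz2 hτ₁ τ⁻¹ f g hf.1
    (by rw [embPerm_inv, inv_inv]; exact hg.2)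
  have e1 : (permMat _ z * Imn (t + s) (t + r) t * permMat _ u⁻¹)ᵀ =
      permMat _ u * Imn (t + r) (t + s) t * permMat _ z⁻¹ := by
    rw [Matrix.transpose_mul, Matrix.transpose_mul, perm_T, perm_T, Imn_T, inv_inv, Matrix.mul_assoc]
  rw [e1]
  convert e using 1
  rw [embPerm_inv, embPerm_inv, inv_inv, Matrix.mul_assoc f, Imn_emb_comm h' h]
  simp only [Matrix.transpose_mul, Imn_T, perm_T, Matrix.transpose_transpose, embPerm_inv, inv_inv,
    Matrix.mul_assoc]

theorem disj_aux {y : Equiv.Perm (Fin (t + s))} (hy : tailMono t y)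
    {a a' : Equiv.Perm (Fin (t + s))} {g g' : Mat (t + s) (t + s)} (hg : g ∈ RI y a)
    (hg' : g' ∈ RI y a') {K K' : Mat t t} (hK' : IsUnit K') {F F' : Mat (t + r) (t + r)}
    (hF' : IsUnit F')
    (e : g * blk K 0 0 (0 : Mat s r) * F = g' * blk K' 0 0 (0 : Mat s r) * F') (i : Fin s) :
    a' (Fin.natAdd t i) ≤ a (Fin.natAdd t i) := by
  obtain ⟨⟨b1, hb1, b2, hb2, eg⟩, c, hc, egc⟩ := hg
  obtain ⟨⟨b1', hb1', b2', hb2', eg'⟩, c', hc', egc'⟩ := hg'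
  have hgu : IsUnit g := by rw [egc]; exact hc.1.mul (perm_unit _)
  have hp : g * (g⁻¹ * g') = g' := Matrix.mul_nonsing_inv_cancel_left _ _ (unit_det hgu)
  have hpu : IsUnit (g⁻¹ * g') := by
    refine IsUnit.mul ?_ (by rw [egc']; exact hc'.1.mul (perm_unit _))
    exact (Matrix.isUnit_nonsing_inv_iff).2 hgu
  have hpe : g⁻¹ * g' = permMat _ a⁻¹ * (c⁻¹ * c') * permMat _ a' := by
    have : g * (permMat _ a⁻¹ * (c⁻¹ * c') * permMat _ a') = g' := by
      rw [egc, egc']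
      calc c * permMat _ a * (permMat _ a⁻¹ * (c⁻¹ * c') * permMat _ a')
          = c * ((permMat _ a * permMat _ a⁻¹) * (c⁻¹ * (c' * permMat _ a'))) := by
            simp only [Matrix.mul_assoc]
        _ = _ := by
            rw [perm_mul_inv, Matrix.one_mul, Matrix.mul_nonsing_inv_cancel_left _ _ (unit_det hc.1)]
    rw [← this, Matrix.nonsing_inv_mul_cancel_left _ _ (unit_det hgu)]
  have hq : (g⁻¹ * g') * blk K' 0 0 (0 : Mat s r) = blk K 0 0 (0 : Mat s r) * (F * F'⁻¹) := by
    calc (g⁻¹ * g') * blk K' 0 0 (0 : Mat s r)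
        = g⁻¹ * (g' * blk K' 0 0 (0 : Mat s r) * F' * F'⁻¹) := by
          rw [Matrix.mul_nonsing_inv_cancel_right _ _ (unit_det hF'), Matrix.mul_assoc]
      _ = g⁻¹ * (g * (blk K 0 0 (0 : Mat s r) * (F * F'⁻¹))) := by
          rw [← e]; simp only [Matrix.mul_assoc]
      _ = _ := Matrix.nonsing_inv_mul_cancel_left _ _ (unit_det hgu)
  generalize g⁻¹ * g' = p at *
  obtain ⟨p1, p2, p3, p4, rfl⟩ := exists_blk p
  obtain ⟨q1, q2, q3, q4, hq'⟩ := exists_blk (F * F'⁻¹)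
  rw [hq', blk_mul, blk_mul] at hq
  have h3 := (blk_inj hq).2.2.1
  simp only [Matrix.mul_zero, Matrix.zero_mul, add_zero] at h3
  have hp3 : p3 = 0 := by
    rw [← Matrix.mul_nonsing_inv_cancel_right K' p3 (unit_det hK'), h3, Matrix.zero_mul]
  subst hp3
  -- the upper triangular side
  have hYe : (permMat _ y⁻¹ * (b1⁻¹ * b1') * permMat _ y) * b2' = b2 * blk p1 p2 0 p4 := by
    have h5 : b1 * permMat _ y * (b2 * blk p1 p2 0 p4) = b1' * permMat _ y * b2' := by
      rw [← eg', ← hp, eg]; simp only [Matrix.mul_assoc]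
    calc _ = permMat _ y⁻¹ * (b1⁻¹ * (b1' * permMat _ y * b2')) := by simp only [Matrix.mul_assoc]
      _ = permMat _ y⁻¹ * (b1⁻¹ * (b1 * (permMat _ y * (b2 * blk p1 p2 0 p4)))) := by
          rw [← h5]; simp only [Matrix.mul_assoc]
      _ = _ := by
          rw [Matrix.nonsing_inv_mul_cancel_left _ _ (unit_det hb1.1), ← Matrix.mul_assoc,
            perm_inv_mul, Matrix.one_mul]
  have hbb : b1⁻¹ * b1' ∈ Bp (t + s) := Bp_mul (Bp_inv hb1) hb1'
  have hYu : IsUnit (permMat _ y⁻¹ * (b1⁻¹ * b1') * permMat _ y) :=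
    ((perm_unit _).mul hbb.1).mul (perm_unit _)
  have hYup : ∀ i j : Fin s, j < i → (permMat _ y⁻¹ * (b1⁻¹ * b1') * permMat _ y)
      (Fin.natAdd t i) (Fin.natAdd t j) = 0 := by
    intro i j hij
    rw [mul_perm_apply, perm_mul_apply, inv_inv]
    exact hbb.2 _ _ (hy _ _ (Nat.add_lt_add_left hij t) (by simp))
  generalize permMat _ y⁻¹ * (b1⁻¹ * b1') * permMat _ y = Y at *
  obtain ⟨Y1, Y2, Y3, Y4, rfl⟩ := exists_blk Y
  obtain ⟨A, B, C, D, rfl⟩ := exists_blk b2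
  obtain ⟨rfl, hA, hD⟩ := blk_Bp.1 hb2
  obtain ⟨A', B', C', D', rfl⟩ := exists_blk b2'
  obtain ⟨rfl, hA', hD'⟩ := blk_Bp.1 hb2'
  rw [blk_mul, blk_mul] at hYe
  obtain ⟨-, -, h6, h7⟩ := blk_inj hYe
  simp only [Matrix.mul_zero, Matrix.zero_mul, add_zero, zero_add] at h6 h7
  have hY3 : Y3 = 0 := by
    rw [← Matrix.mul_nonsing_inv_cancel_right A' Y3 (unit_det hA'.1), h6, Matrix.zero_mul]
  subst hY3
  rw [Matrix.zero_mul, zero_add] at h7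
  have hY4 : Y4 ∈ Bp s := ⟨(blk_unit.1 hYu).2, fun i j hij => by simpa using hYup i j hij⟩
  have hp4 : p4 ∈ Bp s := by
    have : p4 = D⁻¹ * (Y4 * D') := by
      rw [h7, Matrix.nonsing_inv_mul_cancel_left _ _ (unit_det hD.1)]
    rw [this]; exact Bp_mul (Bp_inv hD) (Bp_mul hY4 hD')
  have hne := Bp_diag hp4 i
  have hcc : c⁻¹ * c' ∈ Bm (t + s) := Bm_mul (Bm_inv hc) hc'
  by_contra hcon
  apply hne
  have h8 := congrFun (congrFun hpe (Fin.natAdd t i)) (Fin.natAdd t i)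
  rw [blk_rr, mul_perm_apply, perm_mul_apply, inv_inv] at h8
  rw [h8]
  exact hcc.2 _ _ (not_le.1 hcon)

theorem perm_tail_eq (h : t ≤ t + s) {z τ₁ τ₁' : Equiv.Perm (Fin (t + s))} (τ τ' : Equiv.Perm (Fin t))
    (h1 : ∀ i : Fin (t + s), (i:ℕ) < t → τ₁ i = i) (h1' : ∀ i : Fin (t + s), (i:ℕ) < t → τ₁' i = i)
    (e : ∀ i : Fin s, (z * τ₁ * embPerm h τ) (Fin.natAdd t i) =
      (z * τ₁' * embPerm h τ') (Fin.natAdd t i)) : τ₁ = τ₁' := by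
  ext i
  congr 1
  refine Fin.addCases (fun i => ?_) (fun i => ?_) i
  · rw [h1 _ (by simp), h1' _ (by simp)]
  · have := e i
    simpa [embPerm_natAdd] using this

theorem disj_main (h : t ≤ t + s) (h' : t ≤ t + r) {y z : Equiv.Perm (Fin (t + s))} (hy : tailMono t y)
    {τ₁ τ₁' : Equiv.Perm (Fin (t + s))} (τ τ' : Equiv.Perm (Fin t))
    (h1 : ∀ i : Fin (t + s), (i:ℕ) < t → τ₁ i = i) (h1' : ∀ i : Fin (t + s), (i:ℕ) < t → τ₁' i = i)
    {g g' : Mat (t + s) (t + s)} (hg : g ∈ RI y (z * τ₁ * embPerm h τ))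
    (hg' : g' ∈ RI y (z * τ₁' * embPerm h τ')) {f f' : Mat (t + r) (t + r)}
    (hf : IsUnit f) (hf' : IsUnit f')
    (e : g * Imn (t + s) (t + r) t * permMat _ (embPerm h' τ)⁻¹ * fᵀ =
      g' * Imn (t + s) (t + r) t * permMat _ (embPerm h' τ')⁻¹ * f'ᵀ) : τ₁ = τ₁' := by
  have key : ∀ σ : Equiv.Perm (Fin t), Imn (t + s) (t + r) t * permMat _ (embPerm h' σ)⁻¹ =
      blk (permMat t σ⁻¹) 0 0 (0 : Mat s r) := by
    intro σ
    rw [embPerm_inv, embPerm_blk, Imn_blk, blk_mul]; simp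
  rw [Matrix.mul_assoc g, Matrix.mul_assoc g', key, key] at e
  have hT : ∀ {M : Mat (t + r) (t + r)}, IsUnit M → IsUnit Mᵀ := fun {M} hM => by
    rw [Matrix.isUnit_iff_isUnit_det] at *; rwa [Matrix.det_transpose]
  refine perm_tail_eq h (z := z) τ τ' h1 h1' (fun i => le_antisymm ?_ ?_)
  · exact disj_aux hy hg' hg (perm_unit _) (hT hf) e.symm i
  · exact disj_aux hy hg hg' (perm_unit _) (hT hf') e i

theorem RI_unit {k : ℕ} {y z : Equiv.Perm (Fin k)} {g : Mat k k} (hg : g ∈ RI y z) : IsUnit g := by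
  obtain ⟨-, b, hb, rfl⟩ := hg
  exact hb.1.mul (perm_unit _)

theorem head_le (h : t ≤ t + s) {z τ₁ : Equiv.Perm (Fin (t + s))} (hz : headMono t z)
    (h1 : ∀ i : Fin (t + s), (i:ℕ) < t → τ₁ i = i) (τ : Equiv.Perm (Fin t)) :
    bruhatLE (z * τ₁) (z * τ₁ * embPerm h τ) := by
  apply bruhat_window _ _ {i | (i:ℕ) < t}
  · intro i hi j hj hij
    simp only [Set.mem_setOf_eq] at hi hj
    rw [Equiv.Perm.mul_apply, Equiv.Perm.mul_apply, h1 i hi, h1 j hj]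
    exact hz i j hij hj
  · intro i
    refine Fin.addCases (fun i => ?_) (fun i => ?_) i
    · intro hi; simp at hi
    · intro _; exact embPerm_natAdd _ _ _

theorem tail_le {z τ₁ : Equiv.Perm (Fin (t + s))} (hz : tailMono t z)
    (h1 : ∀ i : Fin (t + s), (i:ℕ) < t → τ₁ i = i) : bruhatLE z (z * τ₁) := by
  apply bruhat_window _ _ {i | t ≤ (i:ℕ)}
  · intro i hi j hj hij
    exact hz i j hij hi
  · intro i hi
    exact h1 i (not_le.1 hi)

/-- right translation by upper triangular matrices -/
theorem mem_RI {y z σ : Equiv.Perm (Fin (t + s))} (hz1 : headMono t z) (hz2 : tailMono t z)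
    {b c : Mat (t + s) (t + s)} (hb : b ∈ Bp (t + s)) (hc : c ∈ Bm (t + s))
    {L : Mat t t} {L2 : Mat s s} (hL : L ∈ Bm t) (hL2 : L2 ∈ Bm s)
    {W : Mat (t + s) (t + s)} (hW : W ∈ Bp (t + s))
    (e : b * permMat _ y = c * permMat _ z * (blk L 0 0 L2 * permMat _ σ * W)) :
    c * permMat _ z * blk L 0 0 L2 * permMat _ σ ∈ RI y (z * σ) := by
  refine ⟨⟨b, hb, W⁻¹, Bp_inv hW, ?_⟩, _, Bm_mul hc (conj_Bm z hz1 hz2 hL hL2), ?_⟩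
  · rw [e]
    have := Matrix.mul_nonsing_inv_cancel_right W (c * permMat _ z * blk L 0 0 L2 * permMat _ σ)
      (unit_det hW.1)
    rw [← this]; simp only [Matrix.mul_assoc]
  · rw [perm_mul]
    calc _ = c * permMat _ z * blk L 0 0 L2 * (permMat _ z⁻¹ * permMat _ z) * permMat _ σ := by
          rw [perm_inv_mul, Matrix.mul_one]
      _ = _ := by simp only [Matrix.mul_assoc]

theorem inter_sub (h : t ≤ t + s) (h' : t ≤ t + r)
    {y z : Equiv.Perm (Fin (t + s))} {u v : Equiv.Perm (Fin (t + r))}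
    (hv1 : headMono t v) (hv2 : tailMono t v) (hz1 : headMono t z) (hz2 : tailMono t z)
    {x : Mat (t + s) (t + r)}
    (hx1 : x ∈ dcPlus (permMat _ y * Imn (t + s) (t + r) t * permMat _ v⁻¹))
    (hx2 : x ∈ dcMinus (permMat _ z * Imn (t + s) (t + r) t * permMat _ u⁻¹)) :
    ∃ (τ₁ : Equiv.Perm (Fin (t + s))) (τ₂ : Equiv.Perm (Fin (t + r))) (τ : Equiv.Perm (Fin t)),
      (∀ i : Fin (t + s), (i:ℕ) < t → τ₁ i = i) ∧ (∀ i : Fin (t + r), (i:ℕ) < t → τ₂ i = i) ∧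
      ∃ g ∈ RI y (z * τ₁ * embPerm h τ), ∃ f ∈ RI u (v * τ₂ * (embPerm h' τ)⁻¹),
        x = g * Imn (t + s) (t + r) t * permMat _ (embPerm h' τ)⁻¹ * fᵀ := by
  obtain ⟨b1, hb1, b2, hb2, e1⟩ := hx1
  obtain ⟨c1, hc1, c2, hc2, e2⟩ := hx2
  set I := Imn (t + s) (t + r) t with hI
  set g0 := b1 * permMat _ y with hg0
  set g1 := c1 * permMat _ z with hg1
  set f0 := b2ᵀ * permMat _ v with hf0
  set f1 := c2ᵀ * permMat _ u with hf1
  have hb2T : b2ᵀ ∈ Bm (t + r) := by rw [Bm_iff]; simpa using hb2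
  have hc2T : c2ᵀ ∈ Bp (t + r) := Bm_iff.1 hc2
  have ug0 : IsUnit g0 := hb1.1.mul (perm_unit _)
  have ug1 : IsUnit g1 := hc1.1.mul (perm_unit _)
  have uf0 : IsUnit f0 := hb2T.1.mul (perm_unit _)
  have uf1 : IsUnit f1 := hc2T.1.mul (perm_unit _)
  have x0 : x = g0 * I * f0ᵀ := by
    rw [e1, hf0, Matrix.transpose_mul, perm_T, Matrix.transpose_transpose]
    simp only [Matrix.mul_assoc, hg0]
  have x1 : x = g1 * I * f1ᵀ := by
    rw [e2, hf1, Matrix.transpose_mul, perm_T, Matrix.transpose_transpose]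
    simp only [Matrix.mul_assoc, hg1]
  have hA0 : g0 = g1 * (g1⁻¹ * g0) := (Matrix.mul_nonsing_inv_cancel_left _ _ (unit_det ug1)).symm
  have hC0 : f1 = f0 * (f0⁻¹ * f1) := (Matrix.mul_nonsing_inv_cancel_left _ _ (unit_det uf0)).symm
  have uA : IsUnit (g1⁻¹ * g0) := (Matrix.isUnit_nonsing_inv_iff.2 ug1).mul ug0
  have uC : IsUnit (f0⁻¹ * f1) := (Matrix.isUnit_nonsing_inv_iff.2 uf0).mul uf1
  generalize g1⁻¹ * g0 = A at *
  generalize f0⁻¹ * f1 = C at *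
  have hAC : A * I = I * Cᵀ := by
    have uf0T : IsUnit f0ᵀ := by
      rw [Matrix.isUnit_iff_isUnit_det] at *; rwa [Matrix.det_transpose]
    have h5 : g1 * (A * I * f0ᵀ) = g1 * (I * Cᵀ * f0ᵀ) := by
      calc g1 * (A * I * f0ᵀ) = (g1 * A) * I * f0ᵀ := by simp only [Matrix.mul_assoc]
        _ = x := by rw [← hA0, x0]
        _ = g1 * I * (f0 * C)ᵀ := by rw [← hC0, x1]
        _ = _ := by rw [Matrix.transpose_mul]; simp only [Matrix.mul_assoc]
    have h6 := congrArg (fun M => g1⁻¹ * M * (f0ᵀ)⁻¹) h5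
    simp only [Matrix.nonsing_inv_mul_cancel_left _ _ (unit_det ug1),
      Matrix.mul_nonsing_inv_cancel_right _ _ (unit_det uf0T)] at h6
    exact h6
  obtain ⟨A1, A2, A3, A4, rfl⟩ := exists_blk A
  obtain ⟨C1, C2, C3, C4, rfl⟩ := exists_blk C
  have hAC' := hAC
  rw [hI, Imn_blk, blk_T, blk_mul, blk_mul] at hAC'
  obtain ⟨q1, q2, q3, -⟩ := blk_inj hAC'
  simp only [Matrix.mul_zero, Matrix.zero_mul, Matrix.mul_one, Matrix.one_mul, add_zero] at q1 q2 q3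
  have hC3 : C3 = 0 := by
    have := congrArg Matrix.transpose q2
    simpa using this.symm
  subst q3 hC3
  obtain ⟨uA1, uA4⟩ := blk_unit.1 uA
  obtain ⟨uC1, uC4⟩ := blk_unit.1 uC
  obtain ⟨L, hL, τ, U, hU, eA1⟩ := lpu A1 uA1
  have hUT : Uᵀ ∈ Bm t := by rw [Bm_iff]; simpa using hU
  have hLT : Lᵀ ∈ Bp t := Bm_iff.1 hL
  have eC1 : C1 = Uᵀ * permMat t τ⁻¹ * Lᵀ := by
    have : C1 = A1ᵀ := by rw [q1, Matrix.transpose_transpose]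
    rw [this, eA1]
    simp [Matrix.mul_assoc, perm_T]
  obtain ⟨L2, hL2, ρ, X, U2, hU2, fA⟩ := par_factor (A2 := A2) h uA4 hL hU eA1
  obtain ⟨L3, hL3, ρ', X', U3, hU3, fC⟩ := par_factor (A2 := C2) h' uC4 hUT hLT eC1
  have hg := mem_RI (y := y) hz1 hz2 hb1 hc1 hL hL2 (blk_Bp.2 ⟨rfl, hU, hU2⟩)
    (W := blk U X 0 U2) (by rw [← fA]; exact hA0)
  have hf := mem_RI (y := u) hv1 hv2 hc2T hb2T hUT hL3 (blk_Bp.2 ⟨rfl, hLT, hU3⟩)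
    (W := blk Lᵀ X' 0 U3) (by rw [← fC]; exact hC0)
  refine ⟨tailPerm ρ, tailPerm ρ', τ, tailPerm_fix ρ, tailPerm_fix ρ', _,
    by rw [mul_assoc]; exact hg, _, by rw [mul_assoc, embPerm_inv]; exact hf, ?_⟩
  have k1 : permMat _ (tailPerm ρ * embPerm h τ) * I * permMat _ (embPerm h' τ)⁻¹ = I := by
    rw [perm_mul, Matrix.mul_assoc, Matrix.mul_assoc, ← Matrix.mul_assoc _ I, emb_conj,
      perm_mul_Imn _ (tailPerm_fix ρ)]
  have k2 : blk L 0 0 L2 * I = I * (blk Lᵀ X' 0 U3)ᵀ := by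
    rw [hI, Imn_blk, blk_T, blk_mul, blk_mul]; simp
  have k3 : f1 = f0 * blk Uᵀ 0 0 L3 * permMat _ (tailPerm ρ' * embPerm h' τ⁻¹) * blk Lᵀ X' 0 U3 := by
    rw [hC0, fC]; simp only [Matrix.mul_assoc]
  calc x = g1 * (I * (blk Lᵀ X' 0 U3)ᵀ) *
        (f0 * blk Uᵀ 0 0 L3 * permMat _ (tailPerm ρ' * embPerm h' τ⁻¹))ᵀ := by
        rw [x1, k3, Matrix.transpose_mul _ (blk Lᵀ X' 0 U3)]
        simp only [Matrix.mul_assoc]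
    _ = g1 * (blk L 0 0 L2 * (permMat _ (tailPerm ρ * embPerm h τ) * I * permMat _ (embPerm h' τ)⁻¹)) *
        (f0 * blk Uᵀ 0 0 L3 * permMat _ (tailPerm ρ' * embPerm h' τ⁻¹))ᵀ := by
        rw [k1, k2]
    _ = _ := by simp only [Matrix.mul_assoc, hg1, hf0]

end
theorem statement18 (m n t : ℕ) (hm : 0 < m) (hn : 0 < n) (htm : t ≤ m) (htn : t ≤ n)
    (y : Equiv.Perm (Fin m)) (v : Equiv.Perm (Fin n))
    (z : Equiv.Perm (Fin m)) (u : Equiv.Perm (Fin n))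
    (hy : tailMono t y) (hv1 : headMono t v) (hv2 : tailMono t v)
    (hz1 : headMono t z) (hz2 : tailMono t z) (hu : tailMono t u)
    (w₁ w₂ : Mat m n)
    (hw₁ : w₁ = permMat m y * Imn m n t * permMat n v⁻¹)
    (hw₂ : w₂ = permMat m z * Imn m n t * permMat n u⁻¹) :
    -- (a)
    ((dcPlus w₁ ∩ dcMinus w₂).Nonempty ↔ bruhatLE z y ∧ bruhatLE v u) ∧
    -- (b)
    (bruhatLE z y → bruhatLE v u →
      (∀ x : Mat m n, x ∈ dcPlus w₁ ∩ dcMinus w₂ ↔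
        ∃ (τ₁ : Equiv.Perm (Fin m)) (τ₂ : Equiv.Perm (Fin n)),
          (∀ i : Fin m, (i:ℕ) < t → τ₁ i = i) ∧ (∀ i : Fin n, (i:ℕ) < t → τ₂ i = i) ∧
          bruhatLE (z * τ₁) y ∧ bruhatLE (v * τ₂) u ∧
          x ∈ Pt m n t htm htn y (v * τ₂) (z * τ₁) u) ∧
      (∀ (τ₁ τ₁' : Equiv.Perm (Fin m)) (τ₂ τ₂' : Equiv.Perm (Fin n)),
        (∀ i : Fin m, (i:ℕ) < t → τ₁ i = i) → (∀ i : Fin n, (i:ℕ) < t → τ₂ i = i) →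
        bruhatLE (z * τ₁) y → bruhatLE (v * τ₂) u →
        (∀ i : Fin m, (i:ℕ) < t → τ₁' i = i) → (∀ i : Fin n, (i:ℕ) < t → τ₂' i = i) →
        bruhatLE (z * τ₁') y → bruhatLE (v * τ₂') u →
        (τ₁, τ₂) ≠ (τ₁', τ₂') →
        Disjoint (Pt m n t htm htn y (v * τ₂) (z * τ₁) u)
                 (Pt m n t htm htn y (v * τ₂') (z * τ₁') u))) := by
  obtain ⟨s, rfl⟩ := Nat.exists_eq_add_of_le htm
  obtain ⟨r, rfl⟩ := Nat.exists_eq_add_of_le htn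
  subst hw₁ hw₂
  have back : ∀ x, x ∈ dcPlus (permMat _ y * Imn (t + s) (t + r) t * permMat _ v⁻¹) ∩
      dcMinus (permMat _ z * Imn (t + s) (t + r) t * permMat _ u⁻¹) →
      ∃ (τ₁ : Equiv.Perm (Fin (t + s))) (τ₂ : Equiv.Perm (Fin (t + r))),
          (∀ i : Fin (t + s), (i:ℕ) < t → τ₁ i = i) ∧ (∀ i : Fin (t + r), (i:ℕ) < t → τ₂ i = i) ∧
          bruhatLE (z * τ₁) y ∧ bruhatLE (v * τ₂) u ∧
          x ∈ Pt (t + s) (t + r) t htm htn y (v * τ₂) (z * τ₁) u := by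
    rintro x ⟨hx1, hx2⟩
    obtain ⟨τ₁, τ₂, τ, h1, h2, g, hg, f, hf, e⟩ := inter_sub htm htn hv1 hv2 hz1 hz2 hx1 hx2
    have B1 := bruhat_of_mem _ _ g hg.1 hg.2
    have B2 := bruhat_of_mem _ _ f hf.1 hf.2
    refine ⟨τ₁, τ₂, h1, h2, bruhat_trans (head_le htm hz1 h1 τ) B1, ?_,
      (Pt_iff _ _ _ _ _ _ _).2 ⟨τ, B1, B2, g, hg, f, hf, e⟩⟩
    have := head_le htn hv1 h2 τ⁻¹
    rw [← embPerm_inv] at this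
    exact bruhat_trans this B2
  refine ⟨⟨?_, ?_⟩, fun _ _ => ⟨fun x => ⟨back x, ?_⟩, ?_⟩⟩
  · rintro ⟨x, hx⟩
    obtain ⟨τ₁, τ₂, h1, h2, B1, B2, -⟩ := back x hx
    exact ⟨bruhat_trans (tail_le hz2 h1) B1, bruhat_trans (tail_le hv2 h2) B2⟩
  · rintro ⟨B1, B2⟩
    obtain ⟨g, hg⟩ := exists_rich _ y z le_rfl B1
    obtain ⟨f, hf⟩ := exists_rich _ u v le_rfl B2
    have e1 : ∀ (k : ℕ) (h : t ≤ t + k), embPerm h (1 : Equiv.Perm (Fin t)) = 1 := by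
      intro k h
      ext i
      congr 1
      refine Fin.addCases (fun i => ?_) (fun i => ?_) i
      · simp [embPerm_castAdd]
      · simp [embPerm_natAdd]
    exact ⟨_, mem_inter_of htm htn (y := y) (z := z) (u := u) (v := v) (τ₁ := 1) (τ₂ := 1)
      hv1 hv2 hz1 hz2 (fun _ _ => rfl) (fun _ _ => rfl) 1
      (g := g) (f := f) (by rw [e1, mul_one, mul_one]; exact hg)
      (by rw [e1, inv_one, mul_one, mul_one]; exact hf)⟩
  · rintro ⟨τ₁, τ₂, h1, h2, -, -, hx⟩
    obtain ⟨τ, -, -, g, hg, f, hf, rfl⟩ := (Pt_iff _ _ _ _ _ _ _).1 hx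
    exact mem_inter_of htm htn hv1 hv2 hz1 hz2 h1 h2 τ hg hf
  · intro τ₁ τ₁' τ₂ τ₂' h1 h2 _ _ h1' h2' _ _ hne
    rw [Set.disjoint_left]
    intro x hx hx'
    obtain ⟨τ, -, -, g, hg, f, hf, e⟩ := (Pt_iff _ _ _ _ _ _ _).1 hx
    obtain ⟨τ', -, -, g', hg', f', hf', e'⟩ := (Pt_iff _ _ _ _ _ _ _).1 hx'
    apply hne
    have E1 : τ₁ = τ₁' := disj_main htm htn hy τ τ' h1 h1' hg hg' (RI_unit hf) (RI_unit hf')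
      (e.symm.trans e')
    have sw : ∀ (σ : Equiv.Perm (Fin t)) (G : Mat (t + s) (t + s)) (H : Mat (t + r) (t + r)),
        (G * Imn (t + s) (t + r) t * permMat _ (embPerm htn σ)⁻¹ * Hᵀ)ᵀ =
        H * Imn (t + r) (t + s) t * permMat _ (embPerm htm σ⁻¹)⁻¹ * Gᵀ := by
      intro σ G H
      rw [embPerm_inv, embPerm_inv, inv_inv, Matrix.mul_assoc H, Imn_emb_comm htn htm]
      simp only [Matrix.transpose_mul, Imn_T, perm_T, Matrix.transpose_transpose, embPerm_inv,
        inv_inv, Matrix.mul_assoc]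
    rw [embPerm_inv] at hf hf'
    have E2 : τ₂ = τ₂' := by
      refine disj_main htn htm hu τ⁻¹ τ'⁻¹ h2 h2' hf hf' (RI_unit hg) (RI_unit hg') ?_
      rw [← sw, ← sw, ← e, ← e']
    rw [E1, E2]
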